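/- arXiv:math/0608330 — 4 statements merged into one kernel-verified Lean document; each statement's English description precedes it below -/
import Mathlib

section
/- Let λ be an infinite cardinal. If λ^{ℵ₀} = λ, or λ is singular of cofinality ℵ₀ and θ^{ℵ₀} < λ for every cardinal θ < λ, then there is a universal reduced torsion-free abelian group of cardinality λ: a reduced torsion-free abelian group of cardinality λ into which every reduced torsion-free abelian group of cardinality λ admits an injective group homomorphism. -/
/-- A bundled abelian group. -/
structure AbGrp where
  carrier : Type
  [grp : AddCommGroup carrier]

attribute [instance] AbGrp.grp

/-- An abelian group is reduced if its only divisible subgroup is trivial. -/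
def IsReducedGrp (G : Type) [AddCommGroup G] : Prop :=
  ∀ D : AddSubgroup G, (∀ d ∈ D, ∀ n : ℕ, 0 < n → ∃ x ∈ D, n • x = d) → D = ⊥

/-- An abelian group is torsion-free if its only element of finite order is `0`. -/
def IsTorsionFreeGrp (G : Type) [AddCommGroup G] : Prop :=
  ∀ x : G, x ≠ 0 → ∀ n : ℕ, 0 < n → n • x ≠ 0

open Cardinal

section Coordinates

variable {G : Type} [AddCommGroup G]

/-- A family in `G` compatible with a filtration by pure subgroups, whose image is a basis of the
span of the image of `G` under a homomorphism to a `ZMod p`-module with kernel `pG`. -/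
theorem exists_filtered_basis_of_ker (p : ℕ) [Fact p.Prime] (P : ℕ → AddSubgroup G)
    (hP : Monotone P)
    (hpure : ∀ n, ∀ m : ℕ, 0 < m → ∀ x, m • x ∈ P n → x ∈ P n)
    {V : Type} [AddCommGroup V] [Module (ZMod p) V] (v : G →+ V)
    (hker : ∀ g, v g = 0 → ∃ h, p • h = g) :
    ∃ B : Set G,
      (∀ c ∈ Finsupp.supported ℤ ℤ B, ∀ h : G,
        Finsupp.linearCombination ℤ id c = p • h → ∀ i, (p : ℤ) ∣ c i) ∧
      ∀ n, ∀ g ∈ P n, ∃ c ∈ Finsupp.supported ℤ ℤ (B ∩ P n), ∃ h ∈ P n,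
        g = Finsupp.linearCombination ℤ id c + p • h := by
  classical
  have hv0 (h : G) : v (p • h) = 0 := by
    rw [map_nsmul, ← Nat.cast_smul_eq_nsmul (ZMod p)]
    simp
  have hv (c : G →₀ ℤ) : v (Finsupp.linearCombination ℤ id c) =
      c.sum fun i a => (a : ZMod p) • v i := by
    rw [Finsupp.linearCombination_apply, Finsupp.sum, map_sum, Finsupp.sum]
    refine Finset.sum_congr rfl fun i _ => ?_
    rw [map_zsmul, Int.cast_smul_eq_zsmul]
    rfl
  let T : Type := {b : Set G // LinearIndepOn (ZMod p) v b}
  have step (b : T) (n : ℕ) : ∃ b' : T, b.1 ⊆ b'.1 ∧ b'.1 ⊆ b.1 ∪ P n ∧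
      ∀ g ∈ b.1 ∪ P n, v g ∈ Submodule.span (ZMod p) (v '' b'.1) := by
    obtain ⟨b', h1, h2, h3, h4⟩ := exists_linearIndepOn_extension b.2
      (Set.subset_union_left (t := (P n : Set G)))
    exact ⟨⟨b', h4⟩, h2, h1, fun g hg => h3 ⟨g, hg, rfl⟩⟩
  choose next hn1 hn2 hn3 using step
  let b : ℕ → T := Nat.rec (next ⟨∅, linearIndepOn_empty _ _⟩ 0) fun n b => next b (n + 1)
  have hbs (n : ℕ) : b (n + 1) = next (b n) (n + 1) := rfl
  have hbmono : Monotone fun n => (b n).1 :=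
    monotone_nat_of_le_succ fun n => by rw [hbs]; exact hn1 _ _
  have hbP (n : ℕ) : (b n).1 ⊆ P n := by
    induction n with
    | zero => exact (hn2 _ _).trans (by simp)
    | succ n ih =>
      rw [hbs]
      exact (hn2 _ _).trans (Set.union_subset (ih.trans (hP n.le_succ)) subset_rfl)
  have hbspan (n : ℕ) : ∀ g ∈ P n, v g ∈ Submodule.span (ZMod p) (v '' (b n).1) := by
    cases n with
    | zero => exact fun g hg => hn3 _ _ g (.inr hg)
    | succ n => exact fun g hg => hn3 _ _ g (.inr hg)
  have hli : LinearIndepOn (ZMod p) v (⋃ n, (b n).1) :=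
    linearIndepOn_iUnion_of_directed hbmono.directed_le fun n => (b n).2
  refine ⟨⋃ n, (b n).1, ?_, ?_⟩
  · intro c hc h hch i
    let c' : G →₀ ZMod p := c.mapRange (Int.cast) Int.cast_zero
    have h0 : c' = 0 := by
      refine linearIndepOn_iff.1 hli c' ?_ ?_
      · exact fun i hi => hc (Finsupp.support_mapRange hi)
      · rw [Finsupp.linearCombination_apply, Finsupp.sum_mapRange_index (by simp), ← hv, hch]
        exact hv0 h
    have := DFunLike.congr_fun h0 i
    rw [← ZMod.intCast_zmod_eq_zero_iff_dvd]
    simpa [c'] using this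
  · intro n g hg
    have := hbspan n g hg
    obtain ⟨l, hl, hlg⟩ := (Finsupp.mem_span_image_iff_linearCombination (ZMod p)).1 this
    let c : G →₀ ℤ := l.mapRange (fun a => (a.val : ℤ)) (by simp)
    have hc : c ∈ Finsupp.supported ℤ ℤ (b n).1 :=
      fun i hi => hl (Finsupp.support_mapRange hi)
    have hcP : Finsupp.linearCombination ℤ id c ∈ P n := by
      rw [Finsupp.linearCombination_apply]
      exact sum_mem fun i hi => zsmul_mem (hbP n (hc hi)) _
    have hvg : v (Finsupp.linearCombination ℤ id c) = v g := by
      rw [hv, ← hlg, Finsupp.linearCombination_apply, Finsupp.sum_mapRange_index (by simp)]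
      simp
    obtain ⟨h, hh⟩ := hker (g - Finsupp.linearCombination ℤ id c)
      (by rw [map_sub, hvg, sub_self])
    refine ⟨c, fun i hi => ⟨Set.mem_iUnion.2 ⟨n, hc hi⟩, hbP n (hc hi)⟩, h, ?_, ?_⟩
    · refine hpure n p (Fact.out : p.Prime).pos _ ?_
      rw [hh]
      exact sub_mem hg hcP
    · rw [hh]; abel

/-- A set whose image is a basis modulo `p`, compatible with a filtration by pure subgroups. -/
theorem exists_filtered_basis_mod (p : ℕ) [Fact p.Prime] (P : ℕ → AddSubgroup G)
    (hP : Monotone P)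
    (hpure : ∀ n, ∀ m : ℕ, 0 < m → ∀ x, m • x ∈ P n → x ∈ P n) :
    ∃ B : Set G,
      (∀ c ∈ Finsupp.supported ℤ ℤ B, ∀ h : G,
        Finsupp.linearCombination ℤ id c = p • h → ∀ i, (p : ℤ) ∣ c i) ∧
      ∀ n, ∀ g ∈ P n, ∃ c ∈ Finsupp.supported ℤ ℤ (B ∩ P n), ∃ h ∈ P n,
        g = Finsupp.linearCombination ℤ id c + p • h := by
  let R : AddSubgroup G := (nsmulAddMonoidHom (α := G) p).range
  let _ : Module (ZMod p) (G ⧸ R) := AddCommGroup.zmodModule (n := p) (by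
    intro x
    obtain ⟨y, rfl⟩ := QuotientAddGroup.mk_surjective x
    rw [← QuotientAddGroup.mk_nsmul, QuotientAddGroup.eq_zero_iff]
    exact ⟨y, rfl⟩)
  exact exists_filtered_basis_of_ker p P hP hpure (QuotientAddGroup.mk' R)
    fun g hg => (QuotientAddGroup.eq_zero_iff g).1 hg

theorem pow_dvd_of_linearCombination_eq (hG : IsTorsionFreeGrp G) {p : ℕ} (hp : 0 < p) {B : Set G}
    (hB : ∀ c ∈ Finsupp.supported ℤ ℤ B, ∀ h : G,
      Finsupp.linearCombination ℤ id c = p • h → ∀ i, (p : ℤ) ∣ c i) (k : ℕ) :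
    ∀ c ∈ Finsupp.supported ℤ ℤ B, ∀ h : G,
      Finsupp.linearCombination ℤ id c = p ^ k • h → ∀ i, (p : ℤ) ^ k ∣ c i := by
  induction k with
  | zero => simp
  | succ k ih =>
    intro c hc h hch i
    have hd := hB c hc (p ^ k • h) (by rw [hch, smul_smul, ← pow_succ'])
    let d : G →₀ ℤ := c.mapRange (fun a => a / p) (by simp)
    have hcd : c = (p : ℤ) • d := by
      ext j
      simp [d, Int.mul_ediv_cancel' (hd j)]
    have hd' : Finsupp.linearCombination ℤ id d = p ^ k • h := by
      by_contra hne
      refine hG _ (sub_ne_zero.2 hne) p hp ?_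
      rw [smul_sub, smul_smul, ← pow_succ', ← hch, hcd, map_smul, natCast_zsmul, sub_self]
    rw [hcd, Finsupp.smul_apply, smul_eq_mul, pow_succ']
    exact mul_dvd_mul_left _ (ih d (fun j hj => hc (Finsupp.support_mapRange hj)) h hd' i)

theorem PadicInt.eq_zero_of_forall_pow_dvd {p : ℕ} [Fact p.Prime] {y : ℤ_[p]}
    (hy : ∀ k : ℕ, (p : ℤ_[p]) ^ k ∣ y) : y = 0 := by
  rw [← PadicInt.ext_of_toZModPow]
  intro n
  rw [map_zero, ← RingHom.mem_ker, PadicInt.ker_toZModPow, Ideal.mem_span_singleton]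
  exact hy n

/-- A filtered `p`-basis gives `p`-adic coordinates on a torsion-free group; they vanish modulo
`p ^ k` outside a finite set, respect the filtration, and detect everything outside `⋂ p ^ k G`. -/
theorem exists_padic_coordinates (hG : IsTorsionFreeGrp G) (p : ℕ) [hp : Fact p.Prime]
    (P : ℕ → AddSubgroup G) (hP : Monotone P)
    (hpure : ∀ n, ∀ m : ℕ, 0 < m → ∀ x, m • x ∈ P n → x ∈ P n) (htop : ∀ g, ∃ n, g ∈ P n) :
    ∃ F : G →+ (G → ℤ_[p]),
      (∀ g (k : ℕ), {i | ¬ (p : ℤ_[p]) ^ k ∣ F g i}.Finite) ∧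
      (∀ n, ∀ g ∈ P n, ∀ i ∉ P n, F g i = 0) ∧
      ∀ g, F g = 0 → ∀ k : ℕ, ∃ h, g = p ^ k • h := by
  classical
  obtain ⟨B, hB, hspan⟩ := exists_filtered_basis_mod p P hP hpure
  have hBk := pow_dvd_of_linearCombination_eq hG hp.out.pos hB
  let R (g : G) (x : G → ℤ_[p]) : Prop := ∀ k : ℕ, ∃ c ∈ Finsupp.supported ℤ ℤ B, ∃ h,
    g = Finsupp.linearCombination ℤ id c + p ^ k • h ∧ ∀ i, (p : ℤ_[p]) ^ k ∣ x i - c i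
  have hRadd {g g' x x'} (h1 : R g x) (h2 : R g' x') : R (g + g') (x + x') := by
    intro k
    obtain ⟨c, hc, h, hg, hx⟩ := h1 k
    obtain ⟨c', hc', h', hg', hx'⟩ := h2 k
    refine ⟨c + c', add_mem hc hc', h + h', ?_, fun i => ?_⟩
    · rw [map_add, smul_add, hg, hg']; abel
    · convert dvd_add (hx i) (hx' i) using 1
      simp only [Pi.add_apply, Finsupp.add_apply]
      push_cast
      ring
  have hRzero {x} (h0 : R 0 x) : x = 0 := by
    funext i
    refine PadicInt.eq_zero_of_forall_pow_dvd fun k => ?_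
    obtain ⟨c, hc, h, hg, hx⟩ := h0 k
    have hd := hBk k c hc (-h) (by rw [smul_neg]; exact eq_neg_of_add_eq_zero_left hg.symm) i
    have hd' : (p : ℤ_[p]) ^ k ∣ (c i : ℤ_[p]) := by
      exact_mod_cast Int.cast_dvd_cast (α := ℤ_[p]) _ _ hd
    simpa using dvd_add (hx i) hd'
  have hRneg {g x} (h1 : R g x) : R (-g) (-x) := by
    intro k
    obtain ⟨c, hc, h, hg, hx⟩ := h1 k
    refine ⟨-c, neg_mem hc, -h, ?_, fun i => ?_⟩
    · rw [map_neg, smul_neg, hg]; abel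
    · convert (dvd_neg.2 (hx i)) using 1
      simp only [Pi.neg_apply, Finsupp.neg_apply]
      push_cast
      ring
  have hRuniq {g x x'} (h1 : R g x) (h2 : R g x') : x = x' := by
    have := hRzero (by simpa using hRadd h1 (hRneg h2) : R 0 (x + -x'))
    rwa [← sub_eq_add_neg, sub_eq_zero] at this
  have hRex (n : ℕ) (g : G) (hg : g ∈ P n) : ∃ x, R g x ∧ ∀ i ∉ P n, x i = 0 := by
    choose! d hd s hs hds using hspan n
    let t (k : ℕ) : G := s^[k] g
    have ht (k : ℕ) : t k ∈ P n := by
      induction k with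
      | zero => exact hg
      | succ k ih =>
        simp only [t, Function.iterate_succ_apply']
        exact hs _ ih
    let c (k : ℕ) : G →₀ ℤ := ∑ j ∈ Finset.range k, (p : ℤ) ^ j • d (t j)
    have hc (k : ℕ) : c k ∈ Finsupp.supported ℤ ℤ (B ∩ P n) :=
      sum_mem fun j _ => Submodule.smul_mem _ _ (hd _ (ht j))
    have hgc (k : ℕ) : g = Finsupp.linearCombination ℤ id (c k) + p ^ k • t k := by
      induction k with
      | zero => simp [c, t]
      | succ k ih =>
        have h1 : t (k + 1) = s (t k) := Function.iterate_succ_apply' _ _ _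
        have h2 : c (k + 1) = c k + (p : ℤ) ^ k • d (t k) := Finset.sum_range_succ _ _
        rw [h1, h2, map_add, map_smul, pow_succ, mul_smul, add_assoc]
        have h3 : (p : ℤ) ^ k • Finsupp.linearCombination ℤ id (d (t k)) =
            p ^ k • Finsupp.linearCombination ℤ id (d (t k)) := by
          rw [← natCast_zsmul]; push_cast; rfl
        rw [h3, ← smul_add, ← hds _ (ht k)]
        exact ih
    have hcauchy (i : G) {m l : ℕ} (hml : m ≤ l) :
        (p : ℤ_[p]) ^ m ∣ (c m i : ℤ_[p]) - (c l i : ℤ_[p]) := by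
      have : (p : ℤ) ^ m ∣ c l i - c m i := by
        have h1 : c l - c m = ∑ j ∈ Finset.Ico m l, (p : ℤ) ^ j • d (t j) :=
          (Finset.sum_Ico_eq_sub _ hml).symm
        rw [← Finsupp.sub_apply, h1, Finsupp.finsetSum_apply]
        refine Finset.dvd_sum fun j hj => ?_
        exact Dvd.dvd.mul_right (pow_dvd_pow _ (Finset.mem_Ico.1 hj).1) _
      have := Int.cast_dvd_cast (α := ℤ_[p]) _ _ this
      push_cast at this
      rwa [dvd_sub_comm] at this
    have hlim (i : G) : ∃ y : ℤ_[p], ∀ k, (p : ℤ_[p]) ^ k ∣ y - c k i := by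
      obtain ⟨y, hy⟩ := IsPrecomplete.prec (I := IsLocalRing.maximalIdeal ℤ_[p])
        (M := ℤ_[p]) inferInstance (f := fun k => (c k i : ℤ_[p])) (fun {m l} hml => by
          rw [SModEq.sub_mem, smul_eq_mul, Ideal.mul_top, PadicInt.maximalIdeal_eq_span_p,
            Ideal.span_singleton_pow, Ideal.mem_span_singleton]
          exact hcauchy i hml)
      refine ⟨y, fun k => ?_⟩
      have := hy k
      rw [SModEq.sub_mem, smul_eq_mul, Ideal.mul_top, PadicInt.maximalIdeal_eq_span_p,
            Ideal.span_singleton_pow, Ideal.mem_span_singleton] at this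
      rwa [dvd_sub_comm]
    choose x hx using hlim
    refine ⟨x, fun k => ⟨c k, fun i hi => (hc k hi).1, t k, hgc k, fun i => hx i k⟩, ?_⟩
    intro i hi
    refine PadicInt.eq_zero_of_forall_pow_dvd fun k => ?_
    have h0 : c k i = 0 := by
      by_contra hne
      exact hi (hc k (Finsupp.mem_support_iff.2 hne)).2
    simpa [h0] using hx i k
  have hRtot (g : G) : ∃ x, R g x := by
    obtain ⟨n, hn⟩ := htop g
    exact (hRex n g hn).imp fun _ => And.left
  choose F hF using hRtot
  refine ⟨AddMonoidHom.mk' F fun a b => hRuniq (hF _) (hRadd (hF a) (hF b)), ?_, ?_, ?_⟩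
  · intro g k
    obtain ⟨c, -, h, -, hx⟩ := hF g k
    refine c.support.finite_toSet.subset fun i hi => ?_
    by_contra hne
    have h0 : c i = 0 := by simpa using hne
    exact hi (by simpa [h0] using hx i)
  · intro n g hg
    obtain ⟨x, hx, hx'⟩ := hRex n g hg
    have : F g = x := hRuniq (hF g) hx
    simpa [this] using hx'
  · intro g hg k
    obtain ⟨c, hc, h, hgc, hx⟩ := hF g k
    have hg' : F g = 0 := hg
    have hdvd (i : G) : (p : ℤ) ^ k ∣ c i := by
      have := hx i
      rw [hg', Pi.zero_apply, zero_sub, dvd_neg] at this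
      exact (PadicInt.pow_p_dvd_int_iff k (c i)).1 (by exact_mod_cast this)
    refine ⟨Finsupp.linearCombination ℤ id
      (c.mapRange (fun a => a / (p : ℤ) ^ k) (by simp)) + h, ?_⟩
    have hc' : c = ((p ^ k : ℕ) : ℤ) • c.mapRange (fun a => a / (p : ℤ) ^ k) (by simp) := by
      ext j
      simp [Int.mul_ediv_cancel' (hdvd j)]
    rw [smul_add]
    conv_lhs => rw [hgc, hc', map_smul, natCast_zsmul]

end Coordinates

section Filtration

theorem mk_levels_le {T : ℕ → Type} [∀ n, Infinite (T n)] (hT : Monotone fun n => #(T n))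
    (n : ℕ) : #{j : Σ n, T n // j.1 ≤ n} ≤ #(T n) := by
  have hemb (m : ℕ) (hm : m ≤ n) : Nonempty (T m ↪ T n) := hT hm
  let f (j : {j : Σ n, T n // j.1 ≤ n}) : ℕ × T n :=
    (j.1.1, (hemb j.1.1 j.2).some j.1.2)
  have hf : Function.Injective f := by
    rintro ⟨⟨a, x⟩, ha⟩ ⟨⟨b, y⟩, hb⟩ h
    obtain rfl : a = b := congrArg Prod.fst h
    obtain rfl : x = y := (hemb a ha).some.injective (congrArg Prod.snd h)
    rfl
  refine (mk_le_of_injective hf).trans ?_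
  simp

instance infinite_levels (T : ℕ → Type) [∀ n, Infinite (T n)] (n : ℕ) :
    Infinite {j : Σ n, T n // j.1 ≤ n} :=
  Infinite.of_injective (fun t : T 0 => ⟨⟨0, t⟩, n.zero_le⟩) fun s t h => by simpa using h

/-- A group is filtered by the pure closures of a filtration of a set of generators. -/
theorem exists_pure_filtration {G : Type} [AddCommGroup G] {T : ℕ → Type} [∀ n, Infinite (T n)]
    (htf : IsTorsionFreeGrp G) (hT : Monotone fun n => #(T n)) (e : G ≃ Σ n, T n) :
    ∃ P : ℕ → AddSubgroup G, Monotone P ∧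
      (∀ n, ∀ m : ℕ, 0 < m → ∀ x, m • x ∈ P n → x ∈ P n) ∧ (∀ g, ∃ n, g ∈ P n) ∧
      ∀ n, ∃ f : G → T n, Set.InjOn f (P n) := by
  classical
  let S (n : ℕ) : Submodule ℤ G := Submodule.span ℤ
    (Set.range fun j : {j : Σ n, T n // j.1 ≤ n} => e.symm j.1)
  have hS : Monotone S := fun m n hmn => Submodule.span_mono <| by
    rintro _ ⟨j, rfl⟩
    exact ⟨⟨j.1, j.2.trans hmn⟩, rfl⟩
  have hScard (n : ℕ) : #(S n) ≤ #(T n) := by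
    have h : #(S n) ≤ #({j : Σ n, T n // j.1 ≤ n} →₀ ℤ) := by
      have := mk_range_le (f := Finsupp.linearCombination ℤ
        fun j : {j : Σ n, T n // j.1 ≤ n} => e.symm j.1)
      rw [← LinearMap.coe_range, Finsupp.range_linearCombination] at this
      exact this
    refine h.trans ?_
    rw [mk_finsupp_of_infinite]
    exact max_le (mk_levels_le hT n) (by simp)
  let P (n : ℕ) : AddSubgroup G :=
    { carrier := {x | ∃ m : ℕ, 0 < m ∧ m • x ∈ S n}
      zero_mem' := ⟨1, one_pos, by simp⟩
      add_mem' := by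
        rintro x y ⟨m, hm, hx⟩ ⟨l, hl, hy⟩
        refine ⟨m * l, Nat.mul_pos hm hl, ?_⟩
        rw [smul_add, mul_smul m l y, mul_comm, mul_smul]
        exact add_mem (nsmul_mem hx l) (nsmul_mem hy m)
      neg_mem' := by
        rintro x ⟨m, hm, hx⟩
        exact ⟨m, hm, by rw [smul_neg]; exact neg_mem hx⟩ }
  have hPmono : Monotone P := by
    rintro m n hmn x ⟨l, hl, hx⟩
    exact ⟨l, hl, hS hmn hx⟩
  refine ⟨P, hPmono, ?_, ?_, ?_⟩
  · rintro n m hm x ⟨l, hl, hx⟩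
    exact ⟨l * m, Nat.mul_pos hl hm, by rwa [mul_smul]⟩
  · refine fun g => ⟨(e g).1, 1, one_pos, ?_⟩
    rw [one_smul]
    exact Submodule.subset_span ⟨⟨e g, le_rfl⟩, e.symm_apply_apply g⟩
  · intro n
    have hPcard : #(P n) ≤ #(T n) := by
      let f (x : P n) : ℕ × S n := (x.2.choose, ⟨_, x.2.choose_spec.2⟩)
      have hf : Function.Injective f := by
        intro x y h
        have h1 : x.2.choose = y.2.choose := congrArg Prod.fst h
        have h2 : x.2.choose • x.1 = y.2.choose • y.1 :=
          congrArg (fun z : ℕ × S n => (z.2 : G)) h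
        rw [← h1] at h2
        by_contra hne
        refine htf _ (sub_ne_zero.2 (Subtype.coe_injective.ne hne)) _ x.2.choose_spec.1 ?_
        rw [smul_sub, h2, sub_self]
      refine (mk_le_of_injective hf).trans ?_
      rw [mk_prod, lift_id, lift_id, mk_nat]
      exact (mul_le_mul_right (hScard n) _).trans (aleph0_mul_eq (aleph0_le_mk _)).le
    obtain ⟨φ⟩ := hPcard
    refine ⟨fun g => if h : g ∈ P n then φ ⟨g, h⟩ else Classical.arbitrary _, fun a ha b hb h => ?_⟩
    have ha' : a ∈ P n := ha
    have hb' : b ∈ P n := hb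
    simp only [ha', hb', dif_pos] at h
    exact congrArg Subtype.val (φ.injective h)

/-- An injection of a filtered group into the index set, respecting the filtrations. -/
theorem exists_filtered_injection {G : Type} [AddCommGroup G] {T : ℕ → Type}
    (P : ℕ → AddSubgroup G) (htop : ∀ g, ∃ n, g ∈ P n)
    (hcard : ∀ n, ∃ f : G → T n, Set.InjOn f (P n)) :
    ∃ ψ : G → Σ n, T n, Function.Injective ψ ∧ ∀ n, ∀ g ∈ P n, (ψ g).1 ≤ n := by
  classical
  choose φ hφ using hcard
  have hinj (a b : ℕ) (g g' : G) (hg : g ∈ P a) (hg' : g' ∈ P b)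
      (h : (⟨a, φ a g⟩ : Σ n, T n) = ⟨b, φ b g'⟩) : g = g' := by
    obtain rfl : a = b := congrArg Sigma.fst h
    exact hφ _ hg hg' (eq_of_heq (Sigma.mk.inj h).2)
  exact ⟨fun g => ⟨Nat.find (htop g), φ _ g⟩,
    fun g g' h => hinj _ _ g g' (Nat.find_spec (htop g)) (Nat.find_spec (htop g')) h,
    fun n g hg => Nat.find_min' _ hg⟩

end Filtration

theorem exists_dvd_of_prime_powers {G : Type} [AddCommGroup G] {g : G}
    (h : ∀ p : ℕ, p.Prime → ∀ k : ℕ, ∃ x, g = p ^ k • x) (n : ℕ) (hn : 0 < n) :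
    ∃ x, g = n • x := by
  induction n using Nat.recOnPosPrimePosCoprime with
  | zero => exact absurd hn (lt_irrefl 0)
  | one => exact ⟨g, (one_smul _ _).symm⟩
  | prime_pow p k hp _ => exact h p hp k
  | coprime a b ha hb hab iha ihb =>
    obtain ⟨x, hx⟩ := iha (by lia)
    obtain ⟨y, hy⟩ := ihb (by lia)
    have hbez : (1 : ℤ) = a * a.gcdA b + b * a.gcdB b := by
      rw [← Nat.gcd_eq_gcd_ab, hab.gcd_eq_one, Nat.cast_one]
    refine ⟨a.gcdA b • y + a.gcdB b • x, ?_⟩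
    calc g = (1 : ℤ) • g := (one_smul _ _).symm
      _ = (a * a.gcdA b : ℤ) • g + (b * a.gcdB b : ℤ) • g := by rw [hbez, add_smul]
      _ = (a * a.gcdA b : ℤ) • b • y + (b * a.gcdB b : ℤ) • a • x := by rw [← hx, ← hy]
      _ = _ := by
        simp only [← natCast_zsmul, smul_add, smul_smul]
        push_cast
        congr 2 <;> ring

theorem eq_zero_of_divisible {G : Type} [AddCommGroup G] (hred : IsReducedGrp G)
    (htf : IsTorsionFreeGrp G) {g : G} (hg : ∀ n : ℕ, 0 < n → ∃ x, g = n • x) : g = 0 := by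
  let D : AddSubgroup G :=
    { carrier := {g | ∀ n : ℕ, 0 < n → ∃ x, g = n • x}
      zero_mem' := fun n _ => ⟨0, (smul_zero n).symm⟩
      add_mem' := fun ha hb n hn => by
        obtain ⟨x, rfl⟩ := ha n hn
        obtain ⟨y, rfl⟩ := hb n hn
        exact ⟨x + y, (smul_add n x y).symm⟩
      neg_mem' := fun ha n hn => by
        obtain ⟨x, rfl⟩ := ha n hn
        exact ⟨-x, (smul_neg n x).symm⟩ }
  have hD : D = ⊥ := hred D fun d hd n hn => by
    obtain ⟨x, rfl⟩ := hd n hn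
    refine ⟨x, fun m hm => ?_, rfl⟩
    obtain ⟨z, hz⟩ := hd (n * m) (Nat.mul_pos hn hm)
    refine ⟨z, ?_⟩
    by_contra hne
    refine htf _ (sub_ne_zero.2 hne) n hn ?_
    rw [smul_sub, hz, mul_smul, sub_self]
  have : g ∈ D := hg
  simpa [hD] using this

section Target

instance fact_prime_of_primes (p : Nat.Primes) : Fact (p : ℕ).Prime := ⟨p.2⟩

/-- Families of `p`-adic integers, for all primes `p`, tending to zero for each `p` and supported in
finitely many levels, uniformly in `p`. -/
def padicFamilies (T : ℕ → Type) : AddSubgroup (∀ p : Nat.Primes, (Σ n, T n) → ℤ_[p]) where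
  carrier := {x | (∀ (p : Nat.Primes) (k : ℕ), {j | ¬ ((p : ℕ) : ℤ_[p]) ^ k ∣ x p j}.Finite) ∧
    ∃ N, ∀ p j, N < j.1 → x p j = 0}
  zero_mem' := by simp
  add_mem' := by
    rintro x y ⟨hx, N, hN⟩ ⟨hy, M, hM⟩
    refine ⟨fun p k => ((hx p k).union (hy p k)).subset fun j hj => ?_, max N M, fun p j hj => ?_⟩
    · by_contra hne
      simp only [Set.mem_union, Set.mem_ofPred_eq, not_or, not_not] at hne
      exact hj (dvd_add hne.1 hne.2)
    · simp [hN p j ((le_max_left _ _).trans_lt hj), hM p j ((le_max_right _ _).trans_lt hj)]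
  neg_mem' := by
    rintro x ⟨hx, N, hN⟩
    exact ⟨fun p k => by simpa using hx p k, N, fun p j hj => by simp [hN p j hj]⟩

variable (T : ℕ → Type)

theorem padicFamilies_torsionFree : IsTorsionFreeGrp (padicFamilies T) := by
  intro x hx n hn h0
  refine hx (Subtype.ext (funext fun p => funext fun j => ?_))
  have h := congrFun (congrFun (congrArg Subtype.val h0) p) j
  have h' : n • x.1 p j = 0 := h
  rw [nsmul_eq_mul, mul_eq_zero] at h'
  exact h'.resolve_left (Nat.cast_ne_zero.2 hn.ne')

theorem padicFamilies_reduced : IsReducedGrp (padicFamilies T) := by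
  intro D hD
  refine (AddSubgroup.eq_bot_iff_forall D).2 fun x hx => Subtype.ext <| funext fun p =>
    funext fun j => PadicInt.eq_zero_of_forall_pow_dvd fun k => ?_
  obtain ⟨y, -, rfl⟩ := hD x hx (p ^ k) (pow_pos p.2.pos k)
  refine ⟨y.1 p j, ?_⟩
  have : ((p : ℕ) ^ k • y).1 p j = (p : ℕ) ^ k • y.1 p j := rfl
  rw [this, nsmul_eq_mul, Nat.cast_pow]

theorem exists_embedding_padicFamilies {G : Type} [AddCommGroup G] (hred : IsReducedGrp G)
    (htf : IsTorsionFreeGrp G) [∀ n, Infinite (T n)] (hT : Monotone fun n => #(T n))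
    (hcard : #G = #(Σ n, T n)) : ∃ f : G →+ padicFamilies T, Function.Injective f := by
  classical
  obtain ⟨e⟩ := Cardinal.eq.1 hcard
  obtain ⟨P, hP, hpure, htop, hinj⟩ := exists_pure_filtration htf hT e
  obtain ⟨ψ, hψ, hψP⟩ := exists_filtered_injection P htop hinj
  choose F hfin hsupp hker using fun p : Nat.Primes =>
    exists_padic_coordinates htf (p : ℕ) P hP hpure htop
  let f (g : G) (p : Nat.Primes) : (Σ n, T n) → ℤ_[p] := Function.extend ψ (F p g) 0
  have hf (g : G) (p : Nat.Primes) (i : G) : f g p (ψ i) = F p g i := hψ.extend_apply _ _ _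
  have hf' (g : G) (p : Nat.Primes) {j} (hj : ¬ ∃ i, ψ i = j) : f g p j = 0 :=
    Function.extend_apply' _ _ _ hj
  have hmem (g : G) : f g ∈ padicFamilies T := by
    refine ⟨fun p k => ((hfin p g k).image ψ).subset fun j hj => ?_, ?_⟩
    · by_cases h : ∃ i, ψ i = j
      · obtain ⟨i, rfl⟩ := h
        exact ⟨i, by simpa [hf] using hj, rfl⟩
      · exact absurd (by simp [hf' g p h]) hj
    · obtain ⟨N, hN⟩ := htop g
      refine ⟨N, fun p j hj => ?_⟩
      by_cases h : ∃ i, ψ i = j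
      · obtain ⟨i, rfl⟩ := h
        rw [hf]
        exact hsupp p N g hN i fun hi => (hψP N i hi).not_gt hj
      · exact hf' g p h
  refine ⟨AddMonoidHom.mk' (fun g => ⟨f g, hmem g⟩) fun a b => ?_, ?_⟩
  · refine Subtype.ext (funext fun p => funext fun j => ?_)
    change f (a + b) p j = f a p j + f b p j
    by_cases h : ∃ i, ψ i = j
    · obtain ⟨i, rfl⟩ := h
      simp [hf]
    · simp [hf' _ p h]
  · rw [injective_iff_map_eq_zero]
    intro g hg
    refine eq_zero_of_divisible hred htf (exists_dvd_of_prime_powers fun p hp => ?_)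
    refine hker ⟨p, hp⟩ g (funext fun i => ?_)
    exact (hf g ⟨p, hp⟩ i).symm.trans (congrFun (congrFun (congrArg Subtype.val hg) ⟨p, hp⟩) (ψ i))

theorem mk_padicFamilies [∀ n, Infinite (T n)] (hT : Monotone fun n => #(T n))
    (hpow : ∀ n, #(T n) ^ ℵ₀ ≤ #(Σ n, T n)) : #(padicFamilies T) = #(Σ n, T n) := by
  classical
  refine le_antisymm ?_ ?_
  · let A (N : ℕ) : Set (padicFamilies T) := {x | ∀ p j, N < j.1 → x.1 p j = 0}
    have hA : ⋃ N, A N = Set.univ := Set.eq_univ_of_forall fun x => Set.mem_iUnion.2 x.2.2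
    have hAcard (N : ℕ) : #(A N) ≤ #(Σ n, T n) := by
      have hfin (x : A N) (p : Nat.Primes) (k : ℕ) :
          {j : {j : Σ n, T n // j.1 ≤ N} |
            (PadicInt.toZModPow k (x.1.1 p j.1)).val ≠ 0}.Finite := by
        refine ((x.1.2.1 p k).preimage Subtype.val_injective.injOn).subset fun j hj => ?_
        intro hdvd
        refine hj ?_
        have : PadicInt.toZModPow k (x.1.1 p j.1) = 0 := by
          rw [← RingHom.mem_ker, PadicInt.ker_toZModPow, Ideal.mem_span_singleton]
          exact hdvd
        rw [this, ZMod.val_zero]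
      let f (x : A N) (q : Nat.Primes × ℕ) : {j : Σ n, T n // j.1 ≤ N} →₀ ℕ :=
        Finsupp.ofSupportFinite (fun j => (PadicInt.toZModPow q.2 (x.1.1 q.1 j.1)).val)
          (hfin x q.1 q.2)
      have hf : Function.Injective f := by
        intro x y h
        refine Subtype.ext (Subtype.ext (funext fun p => funext fun j => ?_))
        by_cases hj : j.1 ≤ N
        · refine PadicInt.ext_of_toZModPow.1 fun k => ?_
          have : NeZero ((p : ℕ) ^ k) := ⟨(pow_pos p.2.pos k).ne'⟩
          exact ZMod.val_injective _ (DFunLike.congr_fun (congrFun h (p, k)) ⟨j, hj⟩)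
        · rw [x.2 p j (not_le.1 hj), y.2 p j (not_le.1 hj)]
      refine (mk_le_of_injective hf).trans ?_
      rw [← power_def, mk_finsupp_of_infinite, mk_eq_aleph0 (Nat.Primes × ℕ)]
      refine (power_le_power_right ?_).trans (hpow N)
      exact max_le (mk_levels_le hT N) (by simp)
    rw [← mk_univ, ← hA]
    refine (mk_iUnion_le_sum_mk).trans ((sum_le_sum _ _ hAcard).trans ?_)
    rw [sum_const', mk_nat]
    exact (aleph0_mul_eq (aleph0_le_mk _)).le
  · let g (j : Σ n, T n) : padicFamilies T := ⟨fun p => Pi.single j 1, fun p k =>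
      (Set.finite_singleton j).subset fun i hi => by
        by_contra hne
        have : i ≠ j := hne
        exact hi (by simp [this]), j.1, fun p i hi => by
          have : i ≠ j := by rintro rfl; exact lt_irrefl _ hi
          simp [this]⟩
    refine mk_le_of_injective (f := g) fun i j h => ?_
    by_contra hne
    have := congrFun (congrFun (congrArg Subtype.val h) ⟨2, Nat.prime_two⟩) i
    simp [g, hne] at this

end Target

section Cardinals

theorem exists_sequence_of_cof_eq_aleph0 {c : Cardinal.{0}} (hc : ℵ₀ < c)
    (hcof : c.ord.cof = ℵ₀) :
    ∃ d : ℕ → Cardinal.{0}, Monotone d ∧ (∀ n, ℵ₀ ≤ d n) ∧ (∀ n, d n < c) ∧ sum d = c := by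
  rw [← Ordinal.cof_toType] at hcof
  obtain ⟨s, hs, hs'⟩ := Order.exists_cof_eq c.ord.ToType
  rw [hcof] at hs'
  obtain ⟨φ⟩ := Cardinal.eq.1 (hs'.trans mk_nat.symm)
  let a (n : ℕ) : Cardinal := #(Set.Iic (φ.symm n).1)
  have ha (n : ℕ) : a n < c := by
    have h1 : #(Set.Iio (φ.symm n).1) < c := by
      simpa using mk_Iio_lt (φ.symm n).1 (by simp)
    have h2 : a n ≤ #(Set.Iio (φ.symm n).1) + 1 := by
      simp only [a]
      rw [← Set.Iio_insert]
      exact mk_insert_le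
    exact h2.trans_lt (add_lt_of_lt hc.le h1 (one_lt_aleph0.trans hc))
  let d (n : ℕ) : Cardinal := ℵ₀ + ∑ m ∈ Finset.range (n + 1), a m
  have hd (n : ℕ) : d n < c := by
    refine add_lt_of_lt hc.le hc ?_
    induction n + 1 with
    | zero => simpa using aleph0_pos.trans hc
    | succ k ih =>
      rw [Finset.sum_range_succ]
      exact add_lt_of_lt hc.le ih (ha k)
  refine ⟨d, ?_, fun n => self_le_add_right _ _, hd, le_antisymm ?_ ?_⟩
  · refine monotone_nat_of_le_succ fun n => ?_
    simp only [d]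
    rw [Finset.sum_range_succ _ (n + 1), ← add_assoc]
    exact self_le_add_right _ _
  · refine (sum_le_sum _ _ fun n => (hd n).le).trans ?_
    rw [sum_const', mk_nat]
    exact (aleph0_mul_eq hc.le).le
  · have hcover : ⋃ n, Set.Iic (φ.symm n).1 = Set.univ := by
      refine Set.eq_univ_of_forall fun x => ?_
      obtain ⟨y, hy, hxy⟩ := hs x
      refine Set.mem_iUnion.2 ⟨φ ⟨y, hy⟩, ?_⟩
      simpa using hxy
    calc c = #(⋃ n, Set.Iic (φ.symm n).1) := by rw [hcover, mk_univ, mk_toType, card_ord]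
      _ ≤ sum a := mk_iUnion_le_sum_mk
      _ ≤ sum d := sum_le_sum _ _ fun n =>
        (Finset.single_le_sum (f := a) (fun _ _ => zero_le) (Finset.self_mem_range_succ n)).trans
          (self_le_add_left _ _)

theorem exists_universal_of_sequence {c : Cardinal.{0}} (d : ℕ → Cardinal.{0}) (hmono : Monotone d)
    (hinf : ∀ n, ℵ₀ ≤ d n) (hsum : sum d = c) (hpow : ∀ n, d n ^ ℵ₀ ≤ c) :
    ∃ H : AbGrp, IsReducedGrp H.carrier ∧ IsTorsionFreeGrp H.carrier ∧
      #H.carrier = c ∧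
      ∀ G : AbGrp, IsReducedGrp G.carrier → IsTorsionFreeGrp G.carrier →
        #G.carrier = c → ∃ f : G.carrier →+ H.carrier, Function.Injective f := by
  let T (n : ℕ) : Type := (d n).out
  have hT (n : ℕ) : #(T n) = d n := mk_out _
  have : ∀ n, Infinite (T n) := fun n => infinite_iff.2 (by rw [hT]; exact hinf n)
  have hTmono : Monotone fun n => #(T n) := by simpa only [hT] using hmono
  have hTsum : #(Σ n, T n) = c := by simp only [mk_sigma, hT, hsum]
  refine ⟨⟨padicFamilies T⟩, padicFamilies_reduced T, padicFamilies_torsionFree T, ?_, ?_⟩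
  · rw [← hTsum]
    exact mk_padicFamilies T hTmono fun n => by rw [hT, hTsum]; exact hpow n
  · intro G hred htf hG
    exact exists_embedding_padicFamilies T hred htf hTmono (hG.trans hTsum.symm)

end Cardinals

/-- Shelah: if `lam^{ℵ₀} = lam`, or `lam` is singular of cofinality `ℵ₀`
with `θ^{ℵ₀} < lam` for all `θ < lam`, then there is a universal reduced torsion-free
abelian group of cardinality `lam`. -/
theorem stmt_10 (lam : Cardinal.{0}) (hinf : Cardinal.aleph0 ≤ lam)
    (hcase : lam ^ Cardinal.aleph0 = lam ∨
      (Cardinal.aleph0 < lam ∧ lam.ord.cof = Cardinal.aleph0 ∧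
        ∀ θ < lam, θ ^ Cardinal.aleph0 < lam)) :
    ∃ H : AbGrp, IsReducedGrp H.carrier ∧ IsTorsionFreeGrp H.carrier ∧
      Cardinal.mk H.carrier = lam ∧
      ∀ G : AbGrp, IsReducedGrp G.carrier → IsTorsionFreeGrp G.carrier →
        Cardinal.mk G.carrier = lam →
          ∃ f : G.carrier →+ H.carrier, Function.Injective f := by
  rcases hcase with hpow | ⟨hlt, hcof, hpow⟩
  · refine exists_universal_of_sequence (fun _ => lam) monotone_const (fun _ => hinf) ?_
      fun _ => hpow.le
    rw [Cardinal.sum_const', Cardinal.mk_nat, Cardinal.aleph0_mul_eq hinf]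
  · obtain ⟨d, hmono, hd, hdlt, hsum⟩ := exists_sequence_of_cof_eq_aleph0 hlt hcof
    exact exists_universal_of_sequence d hmono hd hsum fun n => (hpow _ (hdlt n)).le
end

section
/- Let λ be an infinite cardinal. If λ < 2^{ℵ₀}, or there exists a cardinal μ such that ℶ_ω + μ⁺ < λ, λ is regular, and λ < μ^{ℵ₀}, then there is no universal reduced torsion-free abelian group of cardinality λ: for every reduced torsion-free abelian group G of cardinality λ there exists a reduced torsion-free abelian group of cardinality λ admitting no injective group homomorphism into G. -/
section Guessing

open Cardinal Order Set

variable {L : Type} [ConditionallyCompleteLinearOrderBot L]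

/-- The largest element of the closed set `E` that is at most `b`. -/
noncomputable def retract (E : Set L) (b : L) : L := sSup (E ∩ Iic b)

theorem bddAbove_inter_Iic (E : Set L) (b : L) : BddAbove (E ∩ Iic b) := ⟨b, fun _ hx => hx.2⟩

theorem retract_le (E : Set L) (b : L) : retract E b ≤ b := csSup_le' fun _ hx => hx.2

theorem le_retract {E : Set L} {x b : L} (hx : x ∈ E) (hxb : x ≤ b) : x ≤ retract E b :=
  le_csSup (bddAbove_inter_Iic E b) ⟨hx, hxb⟩

theorem retract_anti {E F : Set L} (h : E ⊆ F) (b : L) : retract E b ≤ retract F b :=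
  csSup_le' fun _ hx => le_retract (h hx.1) hx.2

theorem retract_retract {E F : Set L} (h : E ⊆ F) (b : L) :
    retract E (retract F b) = retract E b := by
  unfold retract
  congr 1
  ext x
  exact ⟨fun hx => ⟨hx.1, hx.2.trans (retract_le F b)⟩,
    fun hx => ⟨hx.1, le_retract (h hx.1) hx.2⟩⟩

theorem retract_mem {E : Set L} (hE : IsClub E) (hbot : ⊥ ∈ E) (b : L) : retract E b ∈ E :=
  hE.csSup_mem inter_subset_left ⟨⊥, hbot, bot_le⟩ (bddAbove_inter_Iic E b)

/-- An antitone family of functions into a well-order, indexed by a linear order without a largest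
element, stabilizes on every set smaller than the cofinality of the index. -/
theorem exists_stable {T : Type} [LinearOrder T] [WellFoundedLT L] [Nonempty T] {S : Type}
    (φ : T → S → L) (hφ : ∀ s, Antitone (φ · s)) (hS : #S < cof T) :
    ∃ t, ∀ t' ≥ t, ∀ s, φ t' s = φ t s := by
  have hmin : ∀ s, ∃ t, ∀ t', φ t s ≤ φ t' s := fun s => by
    obtain ⟨_, ⟨t, rfl⟩, ht⟩ := wellFounded_lt.has_min (range (φ · s)) (range_nonempty _)
    exact ⟨t, fun t' => not_lt.1 (ht _ ⟨t', rfl⟩)⟩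
  choose τ hτ using hmin
  have hb : ¬ IsCofinal (range τ) := fun h => (cof_le h).not_gt (mk_range_le.trans_lt hS)
  obtain ⟨t, ht⟩ := not_isCofinal_iff.1 hb
  exact ⟨t, fun t' ht' s => (hφ s ht').antisymm
    ((hφ s (ht _ ⟨s, rfl⟩).le).trans (hτ s t'))⟩

/-- Club guessing for sets of size `#M` in a regular cardinal above the successor of `#M`, with only
`#L` guesses. -/
theorem exists_clubGuessing {M : Type} [WellFoundedLT L] [IsRegularCardinalOrder L]
    (hM : ℵ₀ ≤ #M) (hML : succ #M < #L) :
    ∃ (I : Type) (c : I → M → L), #I ≤ #L ∧ (∀ i, Function.Injective (c i)) ∧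
      ∀ E : Set L, IsClub E → ⊥ ∈ E → ∃ i, ∀ m, c i m ∈ E := by
  classical
  have hreg := isRegular_succ hM
  let T : Type := (succ #M).ord.ToType
  have hT : #T = succ #M := by simp [T]
  have hcofT : cof T = succ #M := by
    rw [Ordinal.cof_toType, hreg.cof_ord]
  have hcofL : cof L = #L := cof_eq_cardinalMk
  have hTinf : ℵ₀ ≤ cof T := by rw [hcofT]; exact hM.trans (le_succ _)
  have hneT : Nonempty T := by
    rw [← mk_ne_zero_iff, hT]; exact (succ_pos _).ne'
  have hnmT : NoMaxOrder T :=
    (noTopOrder_iff_noMaxOrder T).1 (one_lt_cof_iff.1 (one_lt_aleph0.trans_le hTinf))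
  have hLω : cof L ≠ ℵ₀ := by
    rw [hcofL]; exact ((hM.trans (le_succ _)).trans_lt hML).ne'
  have hIioT : ∀ t : T, #(Iio t) < succ #M := fun t => (mk_Iio_lt t (by simp [T])).trans_eq hT
  -- ladders of type `T`
  let IsLadder (a : L) (e : T → L) : Prop := (∀ t, e t < a) ∧ ∀ x < a, ∃ t, x ≤ e t
  have hlad : ∀ a, ∃ e : T → L, (∃ e', IsLadder a e') → IsLadder a e := fun a => by
    by_cases h : ∃ e', IsLadder a e'
    · exact ⟨h.choose, fun _ => h.choose_spec⟩
    · exact ⟨fun _ => a, fun h' => (h h').elim⟩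
  choose e he using hlad
  let C (E : Set L) (a : L) (t : T) : Set L := (fun s => retract E (e a s)) '' Iio t
  by_contra! hcon
  have hD : ∀ E : Set L, ∃ D : Set L, IsClub D ∧ ⊥ ∈ D ∧
      ∀ a t, #M ≤ #(C E a t) → ¬ C E a t ⊆ D := fun E => by
    let I := {p : L × T // #M ≤ #(C E p.1 p.2)}
    have hemb : ∀ i : I, ∃ f : M → L, Function.Injective f ∧ ∀ m, f m ∈ C E i.1.1 i.1.2 := by
      rintro ⟨p, hp⟩
      obtain ⟨f⟩ := hp
      exact ⟨fun m => f m, Subtype.val_injective.comp f.injective, fun m => (f m).2⟩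
    choose c hc hcC using hemb
    obtain ⟨D, hD, hbot, hne⟩ := hcon I c (by
      refine (mk_subtype_le _).trans ?_
      rw [mk_prod, lift_id, lift_id, hT]
      exact (mul_le_mul_right hML.le _).trans
        (mul_eq_self ((hM.trans (le_succ _)).trans hML.le)).le) hc
    refine ⟨D, hD, hbot, fun a t hat hsub => ?_⟩
    obtain ⟨m, hm⟩ := hne ⟨(a, t), hat⟩
    exact hm (hsub (hcC ⟨(a, t), hat⟩ m))
  choose D hDclub hDbot hDC using hD
  let E : T → Set L := WellFoundedLT.fix fun t ih => ⋂ s : Iio t, D (ih s s.2)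
  have hE : ∀ t, E t = ⋂ s : Iio t, D (E s) := fun t => WellFoundedLT.fix_eq _ t
  have hEanti : Antitone E := fun s t hst => by
    rw [hE s, hE t]
    exact subset_iInter fun u => iInter_subset_of_subset ⟨u.1, lt_of_lt_of_le u.2 hst⟩ subset_rfl
  let F : Set L := ⋂ t, E t
  have hTL : #T < cof L := by rw [hT, hcofL]; exact hML
  have hEclub : ∀ t, IsClub (E t) := fun t => by
    rw [hE]
    refine IsClub.iInter hLω ?_ fun s => hDclub _
    simpa using (mk_subtype_le _).trans_lt hTL
  have hFclub : IsClub F := IsClub.iInter hLω (by simpa using hTL) hEclub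
  have hEbot : ∀ t, ⊥ ∈ E t := fun t => by
    rw [hE]; exact mem_iInter.2 fun s => hDbot _
  -- a ladder inside `F`
  have hseg : Nonempty (T <i L) := by
    rw [← Ordinal.type_lt_iff, Ordinal.type_toType, ← ord_cardinalMk, ord_lt_ord]
    exact hML
  obtain ⟨p⟩ := hseg
  let ε : T → L := fun t => Order.enum F hFclub.isCofinal (p t)
  have hε : StrictMono ε := fun s t h =>
    (Order.enum F hFclub.isCofinal).strictMono (p.strictMono h)
  have hεF : ∀ t, ε t ∈ F := fun t => (Order.enum F hFclub.isCofinal (p t)).2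
  have hbdd : BddAbove (range ε) :=
    .of_not_isCofinal fun h => (cof_le h).not_gt (mk_range_le.trans_lt hTL)
  let a := sSup (range ε)
  have hεa : ∀ t, ε t < a := fun t => by
    obtain ⟨t', ht'⟩ := exists_gt t
    exact (hε ht').trans_le (le_csSup hbdd ⟨t', rfl⟩)
  have haε : ∀ x < a, ∃ t, x ≤ ε t := fun x hx => by
    obtain ⟨_, ⟨t, rfl⟩, ht⟩ := exists_lt_of_lt_csSup (range_nonempty _) hx
    exact ⟨t, ht.le⟩
  obtain ⟨hea, hae⟩ := he a ⟨ε, hεa, haε⟩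
  let ψ : T → L := fun t => retract F (e a t)
  have hψ : succ #M ≤ #(range ψ) := by
    let ε' : T → Iio a := fun t => ⟨ε t, hεa t⟩
    have h1 : cof T = cof (Iio a) := cof_congr_of_strictMono (f := ε') (fun s t h => hε h) (by
      rintro ⟨x, hx⟩
      obtain ⟨t, ht⟩ := haε x hx
      exact ⟨_, ⟨t, rfl⟩, ht⟩)
    rw [← hcofT, h1]
    let ψ' : T → Iio a := fun t => ⟨ψ t, (retract_le _ _).trans_lt (hea t)⟩
    have h2 : IsCofinal (range ψ') := by
      rintro ⟨x, hx⟩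
      obtain ⟨t, ht⟩ := haε x hx
      obtain ⟨s, hs⟩ := hae _ (hεa t)
      exact ⟨_, ⟨s, rfl⟩, ht.trans (le_retract (hεF t) hs)⟩
    refine (cof_le h2).trans ?_
    rw [← mk_image_eq (s := range ψ') Subtype.val_injective, ← range_comp]
    rfl
  obtain ⟨t, ht⟩ : ∃ t, #M ≤ #(ψ '' Iio t) := by
    obtain ⟨f⟩ := (le_succ _).trans hψ
    choose τ hτ using fun m => (f m).2
    obtain ⟨t, ht⟩ := not_isCofinal_iff.1 fun h : IsCofinal (range τ) =>
      (cof_le h).not_gt (mk_range_le.trans_lt (by rw [hcofT]; exact lt_succ _))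
    refine ⟨t, mk_le_of_injective
      (f := fun m => (⟨f m, τ m, ht _ ⟨m, rfl⟩, hτ m⟩ : ψ '' Iio t)) fun m n h => ?_⟩
    exact f.injective (Subtype.ext (congrArg (fun x : ψ '' Iio t => x.1) h))
  obtain ⟨i, hi⟩ := exists_stable (fun (i : T) (s : Iio t) => retract (E i) (e a s))
    (fun s i j hij => retract_anti (hEanti hij) _) (by
      rw [hcofT]; exact hIioT t)
  refine hDC (E i) a t (ht.trans ?_) ?_
  · have : ψ '' Iio t = retract F '' C (E i) a t := by
      simp only [C, image_image, ψ]
      exact image_congr fun s _ => (retract_retract (iInter_subset _ i) _).symm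
    rw [this]
    exact mk_image_le
  · obtain ⟨j, hj⟩ := exists_gt i
    rintro _ ⟨s, hs, rfl⟩
    have h1 := retract_mem (hEclub j) (hEbot j) (e a s)
    rw [hi j hj.le ⟨s, hs⟩, hE j] at h1
    exact mem_iInter.1 h1 ⟨i, hj⟩

theorem isClub_closurePoints [WellFoundedLT L] (hL : ℵ₀ < cof L)
    (hIio : ∀ a : L, #(Iio a) < cof L) (h : L → L) : IsClub {γ : L | ∀ α < γ, h α ≤ γ} := by
  refine ⟨fun t ht _ _ x hx α hα => ?_, fun a => ?_⟩
  · obtain ⟨γ, hγ, hαγ⟩ := (lt_isLUB_iff hx).1 hα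
    exact (ht hγ α hαγ).trans (hx.1 hγ)
  have hstep : ∀ b : L, ∃ b', ∀ α < b, h α < b' := fun b => by
    have hb : ¬ IsCofinal (h '' Iio b) := fun hc =>
      (cof_le hc).not_gt (mk_image_le.trans_lt (hIio b))
    obtain ⟨b', hb'⟩ := not_isCofinal_iff.1 hb
    exact ⟨b', fun α hα => hb' _ ⟨α, hα, rfl⟩⟩
  choose s hs using hstep
  let g : ℕ → L := Nat.rec a fun _ b => s b
  have hg : BddAbove (range g) := .of_not_isCofinal fun hc => (cof_le hc).not_gt
    ((by simpa using mk_range_le_lift (f := g) : #(range g) ≤ ℵ₀).trans_lt hL)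
  refine ⟨sSup (range g), fun α hα => ?_, le_csSup hg ⟨0, rfl⟩⟩
  obtain ⟨_, ⟨n, rfl⟩, hn⟩ := exists_lt_of_lt_csSup (range_nonempty _) hα
  exact (hs (g n) α hn).le.trans (le_csSup hg ⟨n + 1, rfl⟩)

end Guessing

section Separation

theorem norm_padic_inv_le_one {q : ℕ} [Fact q.Prime] {m : ℕ} (hm : q.Coprime m) :
    ‖(((m : ℚ)⁻¹ : ℚ) : ℚ_[q])‖ ≤ 1 := by
  rw [Rat.cast_inv, Rat.cast_natCast, norm_inv, Padic.norm_natCast_eq_one_iff.2 hm, inv_one]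

/-- If the maps to the `q`-adic integers, `q` prime, separate the elements of a group, then this
group is reduced and torsion-free. -/
theorem isReducedGrp_and_isTorsionFreeGrp {V : Type} [AddCommGroup V] (H : AddSubgroup V)
    (hsep : ∀ v ∈ H, v ≠ 0 → ∃ (q : ℕ) (_ : Fact q.Prime) (g : V →+ ℚ_[q]),
      g v ≠ 0 ∧ ∀ w ∈ H, ‖g w‖ ≤ 1) :
    IsReducedGrp H ∧ IsTorsionFreeGrp H := by
  constructor
  · refine fun D hD => (AddSubgroup.eq_bot_iff_forall _).2 fun d hd => ?_
    by_contra hd0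
    obtain ⟨q, hq, g, hgd, hg⟩ := hsep d d.2 (by simpa using hd0)
    have hq1 : (1 : ℝ) < q := by exact_mod_cast hq.out.one_lt
    obtain ⟨k, hk⟩ := exists_pow_lt_of_lt_one (norm_pos_iff.2 hgd) (inv_lt_one_of_one_lt₀ hq1)
    obtain ⟨x, -, rfl⟩ := hD d hd (q ^ k) (pow_pos hq.out.pos k)
    refine hk.not_ge ?_
    have : g ((q ^ k • x : H) : V) = (q : ℚ_[q]) ^ k * g x := by simp
    rw [this, norm_mul, norm_pow, Padic.norm_p]
    exact mul_le_of_le_one_right (by positivity) (hg x x.2)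
  · intro x hx n hn h
    obtain ⟨q, hq, g, hgx, -⟩ := hsep x x.2 (by simpa using hx)
    have : (n : ℚ_[q]) * g x = 0 := by
      have h' := congrArg (fun y : H => g y) h
      simpa using h'
    simp [hn.ne', hgx] at this

end Separation

section Divisibility

variable {G : Type} [AddCommGroup G]

theorem exists_nsmul_eq_of_coprime {m n : ℕ} (h : m.Coprime n) {g : G}
    (hm : ∃ w, m • w = g) (hn : ∃ w, n • w = g) : ∃ w, (m * n) • w = g := by
  obtain ⟨u, hu⟩ := hm
  obtain ⟨v, hv⟩ := hn
  have hb : (m : ℤ) * m.gcdA n + n * m.gcdB n = 1 := by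
    rw [← Nat.gcd_eq_gcd_ab, h.gcd_eq_one, Nat.cast_one]
  refine ⟨m.gcdA n • v + m.gcdB n • u, ?_⟩
  calc (m * n) • (m.gcdA n • v + m.gcdB n • u)
      = ((m : ℤ) * m.gcdA n) • (n • v) + ((n : ℤ) * m.gcdB n) • (m • u) := by module
    _ = ((m : ℤ) * m.gcdA n + n * m.gcdB n) • g := by rw [hu, hv, add_smul]
    _ = g := by rw [hb, one_smul]

theorem IsTorsionFreeGrp.nsmul_left_cancel (htf : IsTorsionFreeGrp G) {n : ℕ} (hn : 0 < n) {x y : G}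
    (h : n • x = n • y) : x = y := by
  by_contra hxy
  exact htf (x - y) (sub_ne_zero.2 hxy) n hn (by rw [nsmul_sub, h, sub_self])

theorem eq_zero_of_forall_exists_nsmul (hred : IsReducedGrp G) (htf : IsTorsionFreeGrp G) {g : G}
    (hg : ∀ n : ℕ, 0 < n → ∃ w, n • w = g) : g = 0 := by
  let D : AddSubgroup G :=
    { carrier := {g | ∀ n : ℕ, 0 < n → ∃ w, n • w = g}
      zero_mem' := fun n _ => ⟨0, smul_zero n⟩
      add_mem' := fun ha hb n hn => by
        obtain ⟨u, rfl⟩ := ha n hn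
        obtain ⟨v, rfl⟩ := hb n hn
        exact ⟨u + v, smul_add ..⟩
      neg_mem' := fun ha n hn => by
        obtain ⟨u, rfl⟩ := ha n hn
        exact ⟨-u, smul_neg ..⟩ }
  have hD : D = ⊥ := hred D fun d hd n hn => by
    obtain ⟨x, hx⟩ := hd n hn
    refine ⟨x, fun m hm => ?_, hx⟩
    obtain ⟨w, hw⟩ := hd (n * m) (Nat.mul_pos hn hm)
    refine ⟨w, htf.nsmul_left_cancel hn ?_⟩
    rw [hx, ← mul_smul, hw]
  have : g ∈ D := hg
  rwa [hD] at this

theorem eq_zero_of_divisible_s11 (hred : IsReducedGrp G) (htf : IsTorsionFreeGrp G) {q : ℕ}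
    (hq : q.Prime) {g : G} (h₁ : ∀ m : ℕ, q.Coprime m → ∃ w, m • w = g)
    (h₂ : ∀ k : ℕ, ∃ w, q ^ k • w = g) : g = 0 := by
  refine eq_zero_of_forall_exists_nsmul hred htf fun n hn => ?_
  obtain ⟨k, m, hm, rfl⟩ := Nat.exists_eq_pow_mul_and_not_dvd hn.ne' q hq.ne_one
  have hqm : q.Coprime m := hq.coprime_iff_not_dvd.2 hm
  exact exists_nsmul_eq_of_coprime (hqm.pow_left k) (h₂ k) (h₁ m hqm)

theorem IsTorsionFreeGrp.exists_pow_nsmul_eq (htf : IsTorsionFreeGrp G) {q : ℕ} (hq : q.Prime)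
    {d : ℤ} {l k : ℕ} (hd : ¬ (q : ℤ) ^ l ∣ d) {g w : G} (hw : q ^ (l + k) • w = d • g) :
    ∃ u, q ^ k • u = g := by
  obtain ⟨j, -, hj⟩ := (Nat.dvd_prime_pow hq).1
    (Int.natCast_dvd_natCast.1 (by simpa using Int.gcd_dvd_right d ((q : ℤ) ^ (l + k))) :
      Int.gcd d ((q : ℤ) ^ (l + k)) ∣ q ^ (l + k))
  have hjd : (q : ℤ) ^ j ∣ d := by
    have := Int.gcd_dvd_left d ((q : ℤ) ^ (l + k))
    rw [hj] at this
    exact_mod_cast this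
  obtain ⟨i, rfl⟩ : ∃ i, l = j + i := by
    refine Nat.exists_eq_add_of_le (le_of_not_ge fun hlj => hd ((pow_dvd_pow _ hlj).trans hjd))
  have hb := Int.gcd_eq_gcd_ab d ((q : ℤ) ^ (j + i + k))
  rw [hj] at hb
  set A := Int.gcdA d ((q : ℤ) ^ (j + i + k))
  set B := Int.gcdB d ((q : ℤ) ^ (j + i + k))
  refine ⟨q ^ i • (A • w + B • g), htf.nsmul_left_cancel (pow_pos hq.pos j) ?_⟩
  have hw' : ((q : ℤ) ^ (j + i + k)) • w = d • g := by exact_mod_cast hw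
  calc q ^ j • q ^ k • q ^ i • (A • w + B • g)
      = A • (((q : ℤ) ^ (j + i + k)) • w) + (((q : ℤ) ^ (j + i + k)) * B) • g := by
        rw [← natCast_zsmul, ← natCast_zsmul, ← natCast_zsmul]; push_cast; module
    _ = (d * A + ((q : ℤ) ^ (j + i + k)) * B) • g := by rw [hw']; module
    _ = q ^ j • g := by rw [← hb, natCast_zsmul]

end Divisibility

section Integral

/-- The elements of `V` whose image under `g` is a `q`-adic integer. -/
noncomputable def integralSubgroup {V : Type} [AddCommGroup V] {q : ℕ} [Fact q.Prime]
    (g : V →+ ℚ_[q]) :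
    AddSubgroup V :=
  (PadicInt.subring q).toAddSubgroup.comap g

theorem mem_integralSubgroup {V : Type} [AddCommGroup V] {q : ℕ} [Fact q.Prime] {g : V →+ ℚ_[q]}
    {v : V} : v ∈ integralSubgroup g ↔ ‖g v‖ ≤ 1 := Iff.rfl

/-- The `q`-adic value of a coordinate. -/
noncomputable def padicCoord {L : Type} (q : ℕ) [Fact q.Prime] (i : L) : (L →₀ ℚ) →+ ℚ_[q] :=
  (Rat.castHom ℚ_[q]).toAddMonoidHom.comp (Finsupp.applyAddHom i)

@[simp]
theorem padicCoord_apply {L : Type} (q : ℕ) [Fact q.Prime] (i : L) (b : L →₀ ℚ) :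
    padicCoord q i b = (b i : ℚ_[q]) := rfl

theorem norm_padic_single_le_one {L : Type} {q : ℕ} [Fact q.Prime] {i j : L} {r : ℚ}
    (hr : ‖(r : ℚ_[q])‖ ≤ 1) : ‖((Finsupp.single i r j : ℚ) : ℚ_[q])‖ ≤ 1 := by
  classical
  rw [Finsupp.single_apply]
  split_ifs
  · exact hr
  · simp

end Integral

section TwoAdic

variable {L : Type} (i₀ : L) (a : ℤ_[2])

/-- The functional `(r, b) ↦ r + b i₀ * a`. -/
noncomputable def twistedSum : ℚ × (L →₀ ℚ) →+ ℚ_[2] :=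
  (Rat.castHom ℚ_[2]).toAddMonoidHom.coprod
    ((AddMonoidHom.mulRight (a : ℚ_[2])).comp (padicCoord 2 i₀))

@[simp]
theorem twistedSum_apply (v : ℚ × (L →₀ ℚ)) :
    twistedSum i₀ a v = v.1 + v.2 i₀ * a := rfl

/-- A group in which the `2`-adic integer `a` is coded by the divisibility properties of two
elements. -/
noncomputable def twistedGroup : AddSubgroup (ℚ × (L →₀ ℚ)) :=
  integralSubgroup (twistedSum i₀ a) ⊓
    ⨅ i, integralSubgroup ((padicCoord 3 i).comp (AddMonoidHom.snd ℚ (L →₀ ℚ)))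

variable {i₀ a}

theorem mem_twistedGroup {v : ℚ × (L →₀ ℚ)} : v ∈ twistedGroup i₀ a ↔
    ‖(v.1 + v.2 i₀ * a : ℚ_[2])‖ ≤ 1 ∧ ∀ i, ‖(v.2 i : ℚ_[3])‖ ≤ 1 := by
  simp [twistedGroup, AddSubgroup.mem_inf, AddSubgroup.mem_iInf, mem_integralSubgroup]

theorem twistedGroup_separated : IsReducedGrp (twistedGroup i₀ a) ∧
    IsTorsionFreeGrp (twistedGroup i₀ a) := by
  refine isReducedGrp_and_isTorsionFreeGrp _ fun v hv hv0 => ?_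
  by_cases hb : v.2 = 0
  · refine ⟨2, inferInstance, twistedSum i₀ a, ?_, fun w hw => (mem_twistedGroup.1 hw).1⟩
    simpa [hb] using fun h => hv0 (Prod.ext h hb)
  · obtain ⟨i, hi⟩ := Finsupp.ne_iff.1 hb
    exact ⟨3, inferInstance, (padicCoord 3 i).comp (AddMonoidHom.snd ℚ (L →₀ ℚ)),
      by simpa using hi, fun w hw => (mem_twistedGroup.1 hw).2 i⟩

theorem inv_mem_twistedGroup {m : ℕ} (hm : Nat.Coprime 2 m) :
    (((m : ℚ)⁻¹, 0) : ℚ × (L →₀ ℚ)) ∈ twistedGroup i₀ a :=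
  mem_twistedGroup.2 ⟨by simpa using norm_padic_inv_le_one hm, by simp⟩

theorem single_mem_twistedGroup (i : L) :
    ((0, Finsupp.single i 1) : ℚ × (L →₀ ℚ)) ∈ twistedGroup i₀ a := by
  refine mem_twistedGroup.2 ⟨?_, fun j => norm_padic_single_le_one (by simp)⟩
  rw [Rat.cast_zero, zero_add, norm_mul]
  exact mul_le_one₀ (norm_padic_single_le_one (by simp)) (norm_nonneg _) a.2

theorem appr_mem_twistedGroup (n : ℕ) :
    ((-(a.appr n / 2 ^ n), Finsupp.single i₀ (2 ^ n)⁻¹) : ℚ × (L →₀ ℚ)) ∈ twistedGroup i₀ a := by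
  refine mem_twistedGroup.2 ⟨?_, fun j => norm_padic_single_le_one ?_⟩
  · obtain ⟨c, hc⟩ := Ideal.mem_span_singleton.1 (PadicInt.appr_spec n a)
    have hc' : (a : ℚ_[2]) - a.appr n = 2 ^ n * c := by
      have := congrArg (fun z : ℤ_[2] => (z : ℚ_[2])) hc
      push_cast at this
      exact_mod_cast this
    have h2 : (2 : ℚ_[2]) ^ n ≠ 0 := pow_ne_zero _ two_ne_zero
    have : (((-(a.appr n / 2 ^ n) : ℚ) : ℚ_[2]) +
        ((Finsupp.single i₀ (2 ^ n)⁻¹ i₀ : ℚ) : ℚ_[2]) * a) = c := by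
      rw [Finsupp.single_eq_same]
      push_cast
      field_simp
      linear_combination hc'
    exact this ▸ c.2
  · have := norm_padic_inv_le_one (q := 3) (m := 2 ^ n) (Nat.Coprime.pow_right n (by norm_num))
    simpa using this

theorem mk_twistedGroup [Infinite L] : Cardinal.mk (twistedGroup i₀ a) = Cardinal.mk L := by
  refine le_antisymm ((Cardinal.mk_subtype_le _).trans_eq ?_) ?_
  · simp
  · refine Cardinal.mk_le_of_injective (f := fun i => (⟨_, single_mem_twistedGroup i⟩ :
      twistedGroup i₀ a)) fun i j h => ?_
    have := congrArg (fun v : twistedGroup i₀ a => v.1.2) h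
    exact Finsupp.single_left_injective one_ne_zero this

theorem continuum_le_mk_padicInt_two : Cardinal.continuum ≤ Cardinal.mk ℤ_[2] := by
  have h := continuum_le_cardinal_of_isOpen ℚ_[2]
    (IsUltrametricDist.isOpen_closedBall (0 : ℚ_[2]) one_ne_zero) ⟨0, by simp⟩
  refine h.trans (Cardinal.mk_le_of_injective (f := fun x : Metric.closedBall (0 : ℚ_[2]) 1 =>
    (⟨x.1, mem_closedBall_zero_iff.1 x.2⟩ : ℤ_[2])) fun x y h => Subtype.ext ?_)
  exact congrArg (fun z : ℤ_[2] => (z : ℚ_[2])) h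

theorem exists_twistedGroup_not_embeddable [Infinite L] {G : Type} [AddCommGroup G]
    (hred : IsReducedGrp G) (htf : IsTorsionFreeGrp G)
    (hG : Cardinal.mk (G × G) < Cardinal.continuum) (i₀ : L) :
    ∃ a, ¬ ∃ f : twistedGroup i₀ a →+ G, Function.Injective f := by
  by_contra! hcon
  choose f hf using hcon
  let x (a : ℤ_[2]) (m : ℕ) (hm : Nat.Coprime 2 m) : twistedGroup i₀ a :=
    ⟨_, inv_mem_twistedGroup hm⟩
  let y (a : ℤ_[2]) : twistedGroup i₀ a := ⟨_, single_mem_twistedGroup i₀⟩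
  let z (a : ℤ_[2]) (n : ℕ) : twistedGroup i₀ a := ⟨_, appr_mem_twistedGroup n⟩
  let x₁ (a : ℤ_[2]) : twistedGroup i₀ a := x a 1 (by simp)
  have hx : ∀ a m hm, m • x a m hm = x₁ a := fun a m hm => by
    have : (m : ℚ) ≠ 0 := by rintro h; simp [Nat.cast_eq_zero.1 h] at hm
    refine Subtype.ext (Prod.ext ?_ ?_) <;> simp [x, x₁, this]
  have hz : ∀ a n, 2 ^ n • z a n = y a - a.appr n • x₁ a := fun a n => by
    refine Subtype.ext (Prod.ext ?_ ?_) <;> simp [x, x₁, y, z]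
    field_simp
  have hinj : Function.Injective fun a => (f a (x₁ a), f a (y a)) := fun a b hab => by
    obtain ⟨hX, hY⟩ := Prod.mk.inj hab
    by_contra hne
    have hx0 : f a (x₁ a) = 0 := by
      refine eq_zero_of_divisible_s11 hred htf Nat.prime_two
        (fun m hm => ⟨f a (x a m hm), by rw [← map_nsmul, hx a m hm]⟩) fun k => ?_
      obtain ⟨l, hl⟩ := exists_pow_lt_of_lt_one (norm_pos_iff.2 (sub_ne_zero.2 hne))
        (show (2 : ℝ)⁻¹ < 1 by norm_num)
      refine htf.exists_pow_nsmul_eq (w := f b (z b (l + k)) - f a (z a (l + k)))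
        (d := a.appr (l + k) - b.appr (l + k)) (l := l) Nat.prime_two (fun hd => hl.not_ge ?_) ?_
      · have hap : ∀ c : ℤ_[2], (2 : ℤ_[2]) ^ l ∣ c - c.appr (l + k) := fun c =>
          (pow_dvd_pow _ (Nat.le_add_right l k)).trans
            (Ideal.mem_span_singleton.1 (PadicInt.appr_spec _ c))
        have hd' : (2 : ℤ_[2]) ^ l ∣ a.appr (l + k) - b.appr (l + k) := by
          have := map_dvd (Int.castRingHom ℤ_[2]) hd
          simpa using this
        have : (2 : ℤ_[2]) ^ l ∣ a - b := by
          have := dvd_sub (dvd_add (hap a) hd') (hap b)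
          ring_nf at this ⊢
          exact this
        have := (PadicInt.norm_le_pow_iff_mem_span_pow (a - b) l).2
          (Ideal.mem_span_singleton.2 this)
        simpa [zpow_neg] using this
      · rw [smul_sub, ← map_nsmul, ← map_nsmul, hz, hz, map_sub, map_sub, map_nsmul, map_nsmul,
          ← hX, ← hY]
        module
    have := congrArg (fun v : twistedGroup i₀ a => v.1.1) (hf a (hx0.trans (map_zero _).symm))
    simp [x₁, x] at this
  exact (continuum_le_mk_padicInt_two.trans (Cardinal.mk_le_of_injective hinj)).not_gt hG

end TwoAdic

section LadderGroup

variable {I L : Type} (q : ℕ → ℕ) [∀ n, Fact (q n).Prime] (s : ℕ → I → L)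

/-- The functional `(a, b) ↦ a (n, α) + ∑ b i`, where the sum is over the `i` with `s n i = α`. -/
noncomputable def ladderSum (n : ℕ) (α : L) : (ℕ × L →₀ ℚ) × (I →₀ ℚ) →+ ℚ_[q n] :=
  (padicCoord (q n) (n, α)).coprod
    ((padicCoord (q n) α).comp (Finsupp.mapDomain.addMonoidHom (s n)))

@[simp]
theorem ladderSum_apply (n : ℕ) (α : L) (v : (ℕ × L →₀ ℚ) × (I →₀ ℚ)) :
    ladderSum q s n α v = v.1 (n, α) + (Finsupp.mapDomain (s n) v.2 α : ℚ) := rfl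

/-- A group with generators `x (n, α)`, divisible by all numbers prime to `q n`, and `y i`, such
that `y i - x (n, s n i)` is divisible by all powers of `q n`. -/
noncomputable def ladderGroup : AddSubgroup ((ℕ × L →₀ ℚ) × (I →₀ ℚ)) :=
  (⨅ i, integralSubgroup ((padicCoord 2 i).comp (AddMonoidHom.snd (ℕ × L →₀ ℚ) (I →₀ ℚ)))) ⊓
    ⨅ n, ⨅ α, integralSubgroup (ladderSum q s n α)

variable {q s}

theorem mem_ladderGroup {v : (ℕ × L →₀ ℚ) × (I →₀ ℚ)} : v ∈ ladderGroup q s ↔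
    (∀ i, ‖(v.2 i : ℚ_[2])‖ ≤ 1) ∧ ∀ n α, ‖ladderSum q s n α v‖ ≤ 1 := by
  simp only [ladderGroup, AddSubgroup.mem_inf, AddSubgroup.mem_iInf, mem_integralSubgroup]
  rfl

theorem ladderGroup_separated : IsReducedGrp (ladderGroup q s) ∧
    IsTorsionFreeGrp (ladderGroup q s) := by
  refine isReducedGrp_and_isTorsionFreeGrp _ fun v hv hv0 => ?_
  by_cases hb : v.2 = 0
  · obtain ⟨⟨n, α⟩, hi⟩ := Finsupp.ne_iff.1 fun h : v.1 = 0 => hv0 (Prod.ext h hb)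
    refine ⟨q n, inferInstance, ladderSum q s n α, ?_, fun w hw => (mem_ladderGroup.1 hw).2 n α⟩
    simpa [hb] using hi
  · obtain ⟨i, hi⟩ := Finsupp.ne_iff.1 hb
    exact ⟨2, inferInstance, (padicCoord 2 i).comp (AddMonoidHom.snd (ℕ × L →₀ ℚ) (I →₀ ℚ)),
      by simpa using hi, fun w hw => (mem_ladderGroup.1 hw).1 i⟩

theorem inv_mem_ladderGroup {n : ℕ} (α : L) {m : ℕ} (hm : (q n).Coprime m) :
    ((Finsupp.single (n, α) (m : ℚ)⁻¹, 0) : (ℕ × L →₀ ℚ) × (I →₀ ℚ)) ∈ ladderGroup q s := by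
  classical
  refine mem_ladderGroup.2 ⟨by simp, fun n' α' => ?_⟩
  rw [ladderSum_apply, Finsupp.mapDomain_zero, Finsupp.zero_apply, Rat.cast_zero, add_zero,
    Finsupp.single_apply]
  split_ifs with h
  · obtain ⟨rfl, rfl⟩ := Prod.mk.inj h
    exact norm_padic_inv_le_one hm
  · simp

theorem single_mem_ladderGroup (i : I) :
    ((0, Finsupp.single i 1) : (ℕ × L →₀ ℚ) × (I →₀ ℚ)) ∈ ladderGroup q s := by
  refine mem_ladderGroup.2 ⟨fun j => norm_padic_single_le_one (by simp), fun n α => ?_⟩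
  rw [ladderSum_apply, Finsupp.mapDomain_single, Finsupp.zero_apply, Rat.cast_zero, zero_add]
  exact norm_padic_single_le_one (by simp)

theorem sub_mem_ladderGroup (hq : Function.Injective q) (hq2 : ∀ n, q n ≠ 2) (i : I) (n k : ℕ) :
    ((-Finsupp.single (n, s n i) (((q n ^ k : ℕ) : ℚ)⁻¹),
      Finsupp.single i (((q n ^ k : ℕ) : ℚ)⁻¹)) : (ℕ × L →₀ ℚ) × (I →₀ ℚ)) ∈ ladderGroup q s := by
  classical
  have hcop : ∀ {p : ℕ}, p.Prime → p ≠ q n → p.Coprime (q n ^ k) := fun hp h =>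
    ((Nat.coprime_primes hp Fact.out).2 h).pow_right k
  refine mem_ladderGroup.2 ⟨fun j => norm_padic_single_le_one
    (norm_padic_inv_le_one (hcop Nat.prime_two (hq2 n).symm)), fun n' α => ?_⟩
  rw [ladderSum_apply, Finsupp.mapDomain_single]
  by_cases hn : n' = n
  · subst hn
    simp [Finsupp.single_apply]
  · have : (n, s n i) ≠ (n', α) := fun h => hn (Prod.mk.inj h).1.symm
    rw [Finsupp.neg_apply, Finsupp.single_eq_of_ne' this, neg_zero, Rat.cast_zero, zero_add]
    exact norm_padic_single_le_one (norm_padic_inv_le_one (hcop Fact.out (hq.ne hn)))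

open Cardinal in
theorem mk_ladderGroup [Infinite L] [Nonempty I] (hI : #I ≤ #L) :
    #(ladderGroup q s) = #L := by
  have hL := aleph0_le_mk L
  refine le_antisymm ((mk_subtype_le _).trans ?_) ?_
  · have : #(I →₀ ℚ) ≤ #L := by
      rw [mk_finsupp_of_infinite']
      exact max_le hI (mkRat.trans_le hL)
    rw [mk_prod, lift_id, lift_id, mk_finsupp_of_infinite]
    refine mul_le_of_le hL ?_ this
    simp [hL]
  · refine mk_le_of_injective (f := fun α => (⟨_, inv_mem_ladderGroup (n := 0) (m := 1) α
      (Nat.coprime_one_right _)⟩ : ladderGroup q s)) fun i j h => ?_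
    have := congrArg (fun v : ladderGroup q s => v.1.1) h
    simpa using Finsupp.single_left_injective (by simp) this

end LadderGroup

section Realization

variable {I L M G : Type} [LinearOrder L] [AddCommGroup G] (q : ℕ → ℕ)

/-- The element `y` of `G` codes the sequence `η` relative to the set enumerated by `c` and the
enumeration `ρ` of `G`. -/
def Realizes (ρ : G → L) (c : M → L) (y : G) (η : ℕ → M) : Prop :=
  ∃ z : ℕ → G, ∀ n, (∀ m : ℕ, (q n).Coprime m → ∃ w, m • w = z n) ∧
    (∀ k : ℕ, ∃ w, q n ^ k • w = y - z n) ∧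
    c (η n) ≤ ρ (z n) ∧ ∀ m, c (η n) < c m → ρ (z n) < c m

variable {q}

theorem Realizes.unique (hred : IsReducedGrp G) (htf : IsTorsionFreeGrp G) (hq : ∀ n, (q n).Prime)
    {ρ : G → L} {c : M → L} (hc : Function.Injective c) {y : G} {η η' : ℕ → M}
    (h : Realizes q ρ c y η) (h' : Realizes q ρ c y η') : η = η' := by
  obtain ⟨z, hz⟩ := h
  obtain ⟨z', hz'⟩ := h'
  ext n
  obtain ⟨h₁, h₂, h₃, h₄⟩ := hz n
  obtain ⟨h₁', h₂', h₃', h₄'⟩ := hz' n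
  have hzz : z n = z' n := by
    refine sub_eq_zero.1 (eq_zero_of_divisible_s11 hred htf (hq n) (fun m hm => ?_) fun k => ?_)
    · obtain ⟨u, hu⟩ := h₁ m hm
      obtain ⟨v, hv⟩ := h₁' m hm
      exact ⟨u - v, by rw [smul_sub, hu, hv]⟩
    · obtain ⟨u, hu⟩ := h₂ k
      obtain ⟨v, hv⟩ := h₂' k
      exact ⟨v - u, by rw [smul_sub, hu, hv]; abel⟩
  refine hc (le_antisymm (not_lt.1 fun hlt => ?_) (not_lt.1 fun hlt => ?_))
  · exact (h₄' _ hlt).not_ge (hzz ▸ h₃)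
  · exact (h₄ _ hlt).not_ge (hzz ▸ h₃')

theorem exists_not_realizes (hred : IsReducedGrp G) (htf : IsTorsionFreeGrp G)
    (hq : ∀ n, (q n).Prime) (ρ : G → L) {c : I → M → L} (hc : ∀ i, Function.Injective (c i))
    (hcard : Cardinal.mk (I × G) < Cardinal.mk (ℕ → M)) :
    ∃ η : ℕ → M, ∀ i y, ¬ Realizes q ρ (c i) y η := by
  by_contra! hcon
  choose i y hiy using hcon
  refine hcard.not_ge (Cardinal.mk_le_of_injective (f := fun η => (i η, y η)) fun η η' h => ?_)
  obtain ⟨h₁, h₂⟩ := Prod.mk.inj h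
  exact (hiy η).unique hred htf hq (hc _) (h₁ ▸ h₂ ▸ hiy η')

theorem exists_realizes [∀ n, Fact (q n).Prime] (hq : Function.Injective q) (hq2 : ∀ n, q n ≠ 2)
    (ρ : G → L) (c : I → M → L) (η : ℕ → M)
    (f : ladderGroup q (fun n i => c i (η n)) →+ G) (E : Set L) (i : I) (hi : ∀ m, c i m ∈ E)
    (hE : ∀ γ ∈ E, ∀ n α,
      ρ (f ⟨_, inv_mem_ladderGroup (n := n) (m := 1) α (Nat.coprime_one_right _)⟩) < γ ↔ α < γ) :
    ∃ y, Realizes q ρ (c i) y η := by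
  refine ⟨f ⟨_, single_mem_ladderGroup i⟩, fun n => f ⟨_, inv_mem_ladderGroup (n := n) (m := 1)
    (c i (η n)) (Nat.coprime_one_right _)⟩, fun n => ⟨fun m hm => ?_, fun k => ?_, ?_, ?_⟩⟩
  · refine ⟨f ⟨_, inv_mem_ladderGroup (c i (η n)) hm⟩, ?_⟩
    have : (m : ℚ) ≠ 0 := by
      rintro h
      have := (Fact.out : (q n).Prime).ne_one
      simp_all
    rw [← map_nsmul]
    congr 1
    refine Subtype.ext (Prod.ext ?_ ?_) <;> simp [this]
  · refine ⟨f ⟨_, sub_mem_ladderGroup hq hq2 i n k⟩, ?_⟩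
    have : (q n : ℚ) ≠ 0 := Nat.cast_ne_zero.2 (Fact.out : (q n).Prime).ne_zero
    rw [← map_nsmul, ← map_sub]
    congr 1
    refine Subtype.ext (Prod.ext ?_ ?_) <;> simp [this]
  · exact not_lt.1 fun h => lt_irrefl _ ((hE _ (hi _) n _).1 h)
  · exact fun m hm => (hE _ (hi m) n _).2 hm

end Realization

section Uncountable

open Cardinal Order Set

theorem exists_isClub_forall_lt_iff {L : Type} [ConditionallyCompleteLinearOrderBot L]
    [WellFoundedLT L] (hL : ℵ₀ < cof L) (hIio : ∀ a : L, #(Iio a) < cof L) (x : ℕ → L → L)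
    (hx : ∀ n, Function.Injective (x n)) :
    ∃ E : Set L, IsClub E ∧ ⊥ ∈ E ∧ ∀ γ ∈ E, ∀ n α, x n α < γ ↔ α < γ := by
  have hbound : ∀ α, ∃ b, ∀ n, x n α < b ∧ ∀ β, x n β = α → β < b := fun α => by
    let S : Set L := ⋃ n, {x n α} ∪ x n ⁻¹' {α}
    have hS : S.Countable := countable_iUnion fun n => (countable_singleton _).union
      ((countable_singleton _).preimage (hx n))
    obtain ⟨b, hb⟩ := not_isCofinal_iff.1 fun h : IsCofinal S =>
      (cof_le h).not_gt ((le_aleph0_iff_set_countable.2 hS).trans_lt hL)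
    exact ⟨b, fun n => ⟨hb _ (mem_iUnion.2 ⟨n, .inl rfl⟩),
      fun β hβ => hb _ (mem_iUnion.2 ⟨n, .inr hβ⟩)⟩⟩
  choose h hh using hbound
  refine ⟨_, isClub_closurePoints hL hIio h, fun α hα => (not_lt_bot hα).elim,
    fun γ hγ n α => ⟨fun hlt => ?_, fun hlt => ?_⟩⟩
  · exact ((hh _ n).2 α rfl).trans_le (hγ _ hlt)
  · exact (hh α n).1.trans_le (hγ α hlt)

theorem exists_ladderGroup_not_embeddable {L M : Type} [ConditionallyCompleteLinearOrderBot L]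
    [WellFoundedLT L] [IsRegularCardinalOrder L] (hM : ℵ₀ ≤ #M) (hML : succ #M < #L)
    (hLM : #L < #M ^ ℵ₀) (htype : (#L).ord = Ordinal.type (α := L) (· < ·)) {G : Type}
    [AddCommGroup G] (hred : IsReducedGrp G) (htf : IsTorsionFreeGrp G) (hG : #G = #L) :
    ∃ H : AbGrp, IsReducedGrp H.carrier ∧ IsTorsionFreeGrp H.carrier ∧ #H.carrier = #L ∧
      ¬ ∃ f : H.carrier →+ G, Function.Injective f := by
  have hML' : #M < #L := (lt_succ _).trans hML
  have hLinf : ℵ₀ ≤ #L := hM.trans hML'.le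
  have : Infinite L := infinite_iff.2 hLinf
  obtain ⟨I, c, hI, hc, hguess⟩ := exists_clubGuessing hM hML
  have : Nonempty I := ⟨(hguess univ .univ (mem_univ _)).choose⟩
  let q : ℕ → ℕ := fun n => Nat.nth Nat.Prime (n + 1)
  have hqp : ∀ n, (q n).Prime := fun n => Nat.prime_nth_prime _
  have : ∀ n, Fact (q n).Prime := fun n => ⟨hqp n⟩
  have hnth := Nat.nth_injective Nat.infinite_setOfPred_prime
  have hq : Function.Injective q := fun m n h => Nat.succ_injective (hnth h)
  have hq2 : ∀ n, q n ≠ 2 := fun n h =>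
    Nat.succ_ne_zero n (hnth (h.trans Nat.nth_prime_zero_eq_two.symm))
  obtain ⟨ρ⟩ := Cardinal.eq.1 hG
  obtain ⟨η, hη⟩ := exists_not_realizes hred htf hqp ρ hc (by
    rw [mk_prod, lift_id, lift_id, hG, mk_pi, prod_const, mk_nat, lift_id, lift_id]
    exact (mul_le_of_le hLinf hI le_rfl).trans_lt hLM)
  refine ⟨⟨ladderGroup q fun n i => c i (η n)⟩, ladderGroup_separated.1, ladderGroup_separated.2,
    mk_ladderGroup hI, fun ⟨f, hf⟩ => ?_⟩
  have hcof : cof L = #L := cof_eq_cardinalMk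
  obtain ⟨E, hE, hbot, hEx⟩ := exists_isClub_forall_lt_iff (L := L)
    (hcof ▸ hM.trans_lt hML') (fun a => hcof ▸ mk_Iio_lt a htype)
    (fun n α => ρ (f ⟨_, inv_mem_ladderGroup (n := n) (m := 1) α (Nat.coprime_one_right _)⟩))
    fun n α β h => by
      have := congrArg (fun v : ladderGroup q (fun n i => c i (η n)) => v.1.1)
        (hf (ρ.injective h))
      simpa using Finsupp.single_left_injective (by simp) this
  obtain ⟨i, hi⟩ := hguess E hE hbot
  obtain ⟨y, hy⟩ := exists_realizes hq hq2 ρ c η f E i hi hEx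
  exact hη i y hy

theorem exists_reduced_not_embeddable_of_lt_continuum {lam : Cardinal.{0}} (hinf : ℵ₀ ≤ lam)
    (hlam : lam < 𝔠) {G : Type} [AddCommGroup G] (hred : IsReducedGrp G) (htf : IsTorsionFreeGrp G)
    (hG : #G = lam) :
    ∃ H : AbGrp, IsReducedGrp H.carrier ∧ IsTorsionFreeGrp H.carrier ∧ #H.carrier = lam ∧
      ¬ ∃ f : H.carrier →+ G, Function.Injective f := by
  subst hG
  have : Infinite G := infinite_iff.2 hinf
  obtain ⟨a, ha⟩ := exists_twistedGroup_not_embeddable hred htf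
    (by rwa [mk_prod, lift_id, mul_eq_self hinf]) (0 : G)
  exact ⟨⟨twistedGroup (0 : G) a⟩, twistedGroup_separated.1, twistedGroup_separated.2,
    mk_twistedGroup, ha⟩

end Uncountable

/-- Shelah: if `lam < 2^{ℵ₀}`, or there is `μ` with
`ℶ_ω + μ⁺ < lam`, `lam` regular and `lam < μ^{ℵ₀}`, then there is no universal reduced
torsion-free abelian group of cardinality `lam`. -/
theorem stmt_11 (lam : Cardinal.{0}) (hinf : Cardinal.aleph0 ≤ lam)
    (hcase : lam < 2 ^ Cardinal.aleph0 ∨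
      ∃ μ : Cardinal.{0}, Cardinal.beth Ordinal.omega0 + Order.succ μ < lam ∧
        lam.IsRegular ∧ lam < μ ^ Cardinal.aleph0)
    (G : AbGrp) (hGred : IsReducedGrp G.carrier) (hGtf : IsTorsionFreeGrp G.carrier)
    (hGcard : Cardinal.mk G.carrier = lam) :
    ∃ H : AbGrp, IsReducedGrp H.carrier ∧ IsTorsionFreeGrp H.carrier ∧
      Cardinal.mk H.carrier = lam ∧
      ¬ ∃ f : H.carrier →+ G.carrier, Function.Injective f := by
  by_cases hlt : lam < 2 ^ Cardinal.aleph0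
  · exact exists_reduced_not_embeddable_of_lt_continuum hinf
      (by rwa [← Cardinal.two_power_aleph0]) hGred hGtf hGcard
  obtain ⟨μ, hμ, hreg, hlamμ⟩ := hcase.resolve_left hlt
  have hμinf : Cardinal.aleph0 ≤ μ := by
    by_contra! h
    refine hlt (hlamμ.trans_le ?_)
    rw [← Cardinal.power_self_eq le_rfl]
    exact Cardinal.power_le_power_right h.le
  have hcof : Order.cof lam.ord.ToType = lam := by rw [Ordinal.cof_toType, hreg.cof_ord]
  have : Nonempty lam.ord.ToType := Cardinal.mk_ne_zero_iff.1 (by simpa using hreg.ne_zero)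
  let : OrderBot lam.ord.ToType := WellFoundedLT.toOrderBot _
  let := WellFoundedLT.conditionallyCompleteLinearOrderBot lam.ord.ToType
  have : IsRegularCardinalOrder lam.ord.ToType := ⟨by rw [hcof, Ordinal.type_toType]⟩
  have hmk : Cardinal.mk lam.ord.ToType = lam := by simp
  have h := exists_ladderGroup_not_embeddable (L := lam.ord.ToType) (M := μ.out)
    (by rwa [Cardinal.mk_out]) (by rw [Cardinal.mk_out, hmk]; exact le_add_self.trans_lt hμ)
    (by rwa [Cardinal.mk_out, hmk]) (by rw [hmk, Ordinal.type_toType]) hGred hGtf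
    (hGcard.trans hmk.symm)
  rwa [hmk] at h
end

section
/- If λ is a regular cardinal with ℵ₁ < λ < 2^{ℵ₀}, then for every cardinal κ < 2^{ℵ₀} and every family {(X, d_i) : i < κ} of metric spaces each of cardinality λ, there exists a metric space of cardinality λ that is not almost isometrically embeddable into any (X, d_i). -/
/-- `d` is a metric on the type `α`. -/
def IsMetricFun {α : Type} (d : α → α → ℝ) : Prop :=
  (∀ x y, d x y = 0 ↔ x = y) ∧ (∀ x y, d x y = d y x) ∧
  (∀ x y z, d x z ≤ d x y + d y z)

/-- `X` with metric `dX` is almost isometrically embeddable into `Y` with metric `dY`: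
for every `r > 1` there is an injection that is bi-Lipschitz with constant `r`. -/
def AlmostIsomEmb {X Y : Type} (dX : X → X → ℝ) (dY : Y → Y → ℝ) : Prop :=
  ∀ r : ℝ, 1 < r → ∃ f : X → Y, Function.Injective f ∧
    ∀ x y : X, x ≠ y → dX x y / r < dY (f x) (f y) ∧ dY (f x) (f y) < r * dX x y

section ClubGuessing

open Cardinal Order Set

theorem exists_forall_lt_of_mk_lt_cof {L ι : Type} [LinearOrder L] (f : ι → L)
    (hι : #ι < cof L) : ∃ b, ∀ i, f i < b := by
  by_contra! H
  have hc : IsCofinal (range f) := fun a ↦ by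
    obtain ⟨i, hi⟩ := H a
    exact ⟨f i, mem_range_self i, hi⟩
  exact absurd ((cof_le hc).trans mk_range_le) hι.not_ge

/-- The points of a linear order that are closed under a function. -/
def closurePoints {L : Type} [LinearOrder L] (h : L → L) : Set L := {a | ∀ b < a, h b < a}

theorem closurePoints_anti {L : Type} [LinearOrder L] {g h : L → L} (hgh : ∀ b, g b ≤ h b) :
    closurePoints h ⊆ closurePoints g :=
  fun _ ha b hb ↦ (hgh b).trans_lt (ha b hb)

theorem exists_strictMono_comp {L : Type} [LinearOrder L] (b : ℕ → L)
    (hb : ∀ n, ∃ m, b n < b m) : ∃ φ : ℕ → ℕ, StrictMono (b ∘ φ) := by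
  choose s hs using hb
  refine ⟨fun n ↦ s^[n] 0, strictMono_nat_of_lt_succ fun n ↦ ?_⟩
  simpa only [Function.comp_apply, Function.iterate_succ_apply'] using hs _

theorem exists_isLeast_of_nonempty {L : Type} [LinearOrder L] [WellFoundedLT L] {s : Set L}
    (hs : s.Nonempty) : ∃ m, IsLeast s m :=
  ⟨wellFounded_lt.min s hs, wellFounded_lt.min_mem s hs,
    fun _ hx ↦ not_lt.1 (wellFounded_lt.not_lt_min s hx)⟩

variable {L : Type} [LinearOrder L]

/-- A transfinite iteration of `N` along `Ω`, dominating all earlier stages. -/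
theorem exists_iterate_dominating {Ω : Type} [LinearOrder Ω] [WellFoundedLT Ω]
    (hΩ : #Ω < cof L) (N : (L → L) → L → L) :
    ∃ H : Ω → L → L, ∀ i j, i < j → ∀ b, H i b ≤ H j b ∧ N (H i) b ≤ H j b := by
  have hbd (j : Ω) (F : ∀ i, i < j → L → L) (b : L) :
      ∃ z, ∀ i (hi : i < j), F i hi b ≤ z ∧ N (F i hi) b ≤ z := by
    have hlt (G : Iio j → L) : ∃ z, ∀ i, G i < z :=
      exists_forall_lt_of_mk_lt_cof G ((mk_le_of_injective Subtype.val_injective).trans_lt hΩ)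
    obtain ⟨z, hz⟩ := hlt fun i ↦ F i.1 i.2 b
    obtain ⟨w, hw⟩ := hlt fun i ↦ N (F i.1 i.2) b
    exact ⟨max z w, fun i hi ↦ ⟨(hz ⟨i, hi⟩).le.trans (le_max_left _ _),
      (hw ⟨i, hi⟩).le.trans (le_max_right _ _)⟩⟩
  choose Z hZ using hbd
  refine ⟨wellFounded_lt.fix Z, fun i j hij b ↦ ?_⟩
  rw [wellFounded_lt.fix_eq Z j]
  exact hZ j (fun i _ ↦ wellFounded_lt.fix Z i) b i hij

open Classical in
/-- A strictly increasing subsequence of `b`, if there is one. -/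
noncomputable def strictSubseq (b : ℕ → L) : ℕ → L :=
  if hb : ∃ φ : ℕ → ℕ, StrictMono (b ∘ φ) then b ∘ hb.choose else b

theorem strictSubseq_mem (b : ℕ → L) (n : ℕ) : ∃ m, strictSubseq b n = b m := by
  unfold strictSubseq
  split_ifs with hb
  · exact ⟨_, rfl⟩
  · exact ⟨n, rfl⟩

theorem strictMono_strictSubseq {b : ℕ → L} (hb : ∀ n, ∃ m, b n < b m) :
    StrictMono (strictSubseq b) := by
  have hb := exists_strictMono_comp b hb
  rw [strictSubseq, dif_pos hb]
  exact hb.choose_spec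

theorem exists_cofinal_seq_ladder (L : Type) [LinearOrder L] :
    ∃ c : L → ℕ → L, ∀ δ, (∃ e : ℕ → L, StrictMono e ∧ IsLUB (range e) δ) →
      StrictMono (c δ) ∧ IsLUB (range (c δ)) δ := by
  have (δ : L) : ∃ c : ℕ → L, (∃ e : ℕ → L, StrictMono e ∧ IsLUB (range e) δ) →
      StrictMono c ∧ IsLUB (range c) δ := by
    by_cases h : ∃ e : ℕ → L, StrictMono e ∧ IsLUB (range e) δ
    · exact ⟨h.choose, fun _ ↦ h.choose_spec⟩
    · exact ⟨fun _ ↦ δ, fun h' ↦ absurd h' h⟩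
  exact Classical.skolem.1 this

theorem StrictMono.lt_of_isLUB_range {c : ℕ → L} {δ : L} (hc : StrictMono c)
    (hδ : IsLUB (range c) δ) (n : ℕ) : c n < δ :=
  (hc n.lt_succ_self).trans_le (hδ.1 (mem_range_self _))

theorem exists_forall_le_lt (hL : ℵ₀ ≤ cof L) (hsmall : ∀ b : L, #(Iio b) < cof L)
    (h : L → L) (x : L) : ∃ y, x < y ∧ ∀ w ≤ x, h w < y := by
  have hunit (z : L) : ∃ y, z < y := by
    obtain ⟨y, hy⟩ := exists_forall_lt_of_mk_lt_cof (fun _ : Unit ↦ z)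
      (mk_lt_aleph0.trans_le hL)
    exact ⟨y, hy ()⟩
  obtain ⟨x', hx'⟩ := hunit x
  obtain ⟨y, hy⟩ := exists_forall_lt_of_mk_lt_cof (fun w : Iio x' ↦ max w.1 (h w)) (hsmall x')
  exact ⟨y, (le_max_left _ _).trans_lt (hy ⟨x, hx'⟩),
    fun w hw ↦ (le_max_right _ _).trans_lt (hy ⟨w, hw.trans_lt hx'⟩)⟩

variable [WellFoundedLT L]

theorem exists_closurePoint_gt (hL : ℵ₀ < cof L) (hsmall : ∀ b : L, #(Iio b) < cof L)
    (h : L → L) (a : L) : ∃ b ∈ closurePoints h, a < b := by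
  choose s hs hh using exists_forall_le_lt hL.le hsmall h
  obtain ⟨u, hu⟩ := exists_forall_lt_of_mk_lt_cof (fun n ↦ s^[n] a) (by simpa using hL)
  obtain ⟨δ, hδ⟩ := exists_isLeast_of_nonempty (s := upperBounds (range fun n ↦ s^[n] a))
    ⟨u, by rintro _ ⟨n, rfl⟩; exact (hu n).le⟩
  have hlt (n : ℕ) : s^[n + 1] a ≤ δ := hδ.1 (mem_range_self (n + 1))
  simp only [Function.iterate_succ_apply'] at hlt
  refine ⟨δ, fun b hb ↦ ?_, (hs a).trans_le (hlt 0)⟩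
  obtain ⟨_, ⟨n, rfl⟩, hn⟩ := (lt_isLUB_iff hδ).1 hb
  exact (hh _ b hn.le).trans_le (hlt n)

/-- The closure points of `h` below `b` have a maximum. -/
theorem exists_isGreatest_closurePoints (h : L → L) (b : L) :
    ∃ m, IsGreatest (closurePoints h ∩ Iic b) m := by
  obtain ⟨m, hm, hmin⟩ := exists_isLeast_of_nonempty
    (s := upperBounds (closurePoints h ∩ Iic b)) ⟨b, fun _ hx ↦ hx.2⟩
  refine ⟨m, ⟨fun c hc ↦ ?_, hmin fun _ hx ↦ hx.2⟩, hm⟩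
  have : c ∉ upperBounds (closurePoints h ∩ Iic b) := fun H ↦ (hmin H).not_gt hc
  simp only [mem_upperBounds, not_forall, not_le] at this
  obtain ⟨x, hx, hcx⟩ := this
  exact (hx.1 c hcx).trans_le (hm hx)

/-- The largest closure point of `h` that is at most `b`. -/
noncomputable def lastClosurePoint (h : L → L) (b : L) : L :=
  (exists_isGreatest_closurePoints h b).choose

theorem isGreatest_lastClosurePoint (h : L → L) (b : L) :
    IsGreatest (closurePoints h ∩ Iic b) (lastClosurePoint h b) :=
  (exists_isGreatest_closurePoints h b).choose_spec

theorem lastClosurePoint_anti {g h : L → L} (hgh : ∀ b, g b ≤ h b) (b : L) :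
    lastClosurePoint h b ≤ lastClosurePoint g b :=
  (isGreatest_lastClosurePoint g b).2
    ⟨closurePoints_anti hgh (isGreatest_lastClosurePoint h b).1.1,
      (isGreatest_lastClosurePoint h b).1.2⟩

theorem exists_forall_eq_of_antitone {Ω : Type} [LinearOrder Ω] [Nonempty Ω] {f : Ω → L}
    (hf : Antitone f) : ∃ i, ∀ j, i ≤ j → f j = f i := by
  obtain ⟨_, ⟨i, rfl⟩, hi⟩ := exists_isLeast_of_nonempty (range_nonempty f)
  exact ⟨i, fun j hij ↦ (hf hij).antisymm (hi (mem_range_self j))⟩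

theorem exists_strictMono_closurePoints (hL : ℵ₀ < cof L) (hsmall : ∀ b : L, #(Iio b) < cof L)
    (h : L → L) [Nonempty L] :
    ∃ (e : ℕ → L) (δ : L), StrictMono e ∧ IsLUB (range e) δ ∧ ∀ n, e n ∈ closurePoints h := by
  choose s hs hlt using exists_closurePoint_gt hL hsmall h
  obtain ⟨a⟩ := ‹Nonempty L›
  have he : StrictMono fun n ↦ s^[n + 1] a := strictMono_nat_of_lt_succ fun n ↦ by
    simpa only [Function.iterate_succ_apply'] using hlt _
  obtain ⟨u, hu⟩ := exists_forall_lt_of_mk_lt_cof (fun n ↦ s^[n + 1] a) (by simpa using hL)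
  obtain ⟨δ, hδ⟩ := exists_isLeast_of_nonempty (s := upperBounds (range fun n ↦ s^[n + 1] a))
    ⟨u, by rintro _ ⟨n, rfl⟩; exact (hu n).le⟩
  exact ⟨_, δ, he, hδ, fun n ↦ by simpa only [Function.iterate_succ_apply'] using hs _⟩

theorem lastClosurePoint_seq_unbounded {h : L → L} {δ : L} {c e : ℕ → L} (hc : StrictMono c)
    (hcδ : IsLUB (range c) δ) (he : StrictMono e) (heδ : IsLUB (range e) δ)
    (heh : ∀ n, e n ∈ closurePoints h) (n : ℕ) :
    ∃ m, lastClosurePoint h (c n) < lastClosurePoint h (c m) := by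
  obtain ⟨_, ⟨k, rfl⟩, hk⟩ := (lt_isLUB_iff heδ).1 (hc.lt_of_isLUB_range hcδ n)
  obtain ⟨_, ⟨m, rfl⟩, hm⟩ := (lt_isLUB_iff hcδ).1 (he.lt_of_isLUB_range heδ k)
  exact ⟨m, ((isGreatest_lastClosurePoint h (c n)).1.2.trans_lt hk).trans_le
    ((isGreatest_lastClosurePoint h (c m)).2 ⟨heh k, hm.le⟩)⟩

/-- Club guessing on points of countable cofinality, for orders of cofinality above `ℵ₁`. -/
theorem exists_club_guessing (hL : ℵ₁ < cof L) (hsmall : ∀ b : L, #(Iio b) < cof L) :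
    ∃ c : L → ℕ → L, ∀ h : L → L, ∃ δ, StrictMono (c δ) ∧ ∀ n, c δ n ∈ closurePoints h := by
  have hL₀ : ℵ₀ < cof L := aleph0_lt_aleph_one.trans hL
  have : Nonempty L := cof_ne_zero_iff.1 (aleph0_pos.trans hL₀).ne'
  obtain ⟨c, hc⟩ := exists_cofinal_seq_ladder L
  let G (h : L → L) (δ : L) : ℕ → L := strictSubseq fun n ↦ lastClosurePoint h (c δ n)
  by_contra! hcon
  choose N hN using fun h ↦ hcon (G h)
  let Ω := (ℵ₁ : Cardinal.{0}).ord.ToType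
  have hΩ : #Ω = ℵ₁ := mk_ord_toType _
  have hcofΩ : cof Ω = ℵ₁ := by rw [Ordinal.cof_toType, isRegular_aleph_one.cof_ord]
  have : Nonempty Ω := cof_ne_zero_iff.1 (hcofΩ.trans_ne (aleph_pos 1).ne')
  obtain ⟨H, hH⟩ := exists_iterate_dominating (Ω := Ω) (hΩ ▸ hL) N
  have hHmono (i j : Ω) (hij : i ≤ j) (b : L) : H i b ≤ H j b := by
    rcases hij.eq_or_lt with rfl | hij
    · rfl
    · exact (hH i j hij b).1
  have htop (b : L) : ∃ z, ∀ i, H i b < z :=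
    exists_forall_lt_of_mk_lt_cof (fun i ↦ H i b) (hΩ ▸ hL)
  choose T hT using htop
  obtain ⟨e, δ, he, heδ, heT⟩ := exists_strictMono_closurePoints hL₀ hsmall T
  obtain ⟨hcδ, hlub⟩ := hc δ ⟨e, he, heδ⟩
  have hstab (n : ℕ) : ∃ i, ∀ j, i ≤ j →
      lastClosurePoint (H j) (c δ n) = lastClosurePoint (H i) (c δ n) :=
    exists_forall_eq_of_antitone (f := fun i ↦ lastClosurePoint (H i) (c δ n))
      fun i j hij ↦ lastClosurePoint_anti (hHmono i j hij) _
  choose s hs using hstab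
  have hω : #ℕ < cof Ω := by rw [hcofΩ, mk_nat]; exact aleph0_lt_aleph_one
  obtain ⟨i, hi⟩ := exists_forall_lt_of_mk_lt_cof s hω
  obtain ⟨j, hj⟩ := exists_forall_lt_of_mk_lt_cof (fun _ : ℕ ↦ i) hω
  replace hj := hj 0
  have hG : G (H i) δ = G (H j) δ := by
    simp only [G, hs _ i (hi _).le, hs _ j ((hi _).trans hj).le]
  have hmono : StrictMono (G (H i) δ) :=
    strictMono_strictSubseq (lastClosurePoint_seq_unbounded hcδ hlub he heδ
      fun n ↦ closurePoints_anti (fun b ↦ (hT b i).le) (heT n))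
  obtain ⟨n, hn⟩ := hN (H i) δ hmono
  rw [hG] at hn
  obtain ⟨m, hm⟩ := strictSubseq_mem (fun n ↦ lastClosurePoint (H j) (c δ n)) n
  refine hn (closurePoints_anti (fun b ↦ (hH i j hj b).2) ?_)
  change strictSubseq _ n ∈ _
  rw [hm]
  exact (isGreatest_lastClosurePoint (H j) (c δ m)).1.1

end ClubGuessing

section TreeMetric

open Classical in
/-- The ultrametric on sequences in which two sequences first differing at `n` have
distance `ε n`. -/
noncomputable def treeDist {L : Type} (ε : ℕ → ℝ) (x y : ℕ → L) : ℝ :=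
  if x = y then 0 else ε (PiNat.firstDiff (E := fun _ ↦ L) x y)

variable {L : Type} {ε : ℕ → ℝ}

theorem isMetricFun_treeDist (hpos : ∀ n, 0 < ε n) (hε : Antitone ε) (Y : Set (ℕ → L)) :
    IsMetricFun fun x y : Y ↦ treeDist ε x.1 y.1 := by
  have hnn (x y : ℕ → L) : 0 ≤ treeDist ε x y := by
    unfold treeDist; split_ifs
    exacts [le_rfl, (hpos _).le]
  refine ⟨fun x y ↦ ?_, fun x y ↦ ?_, fun x y z ↦ ?_⟩
  · simp [treeDist, Subtype.ext_iff, (hpos _).ne']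
  · by_cases hxy : x.1 = y.1
    · simp only [hxy]
    · simp only [treeDist, if_neg hxy, if_neg (Ne.symm hxy), PiNat.firstDiff_comm x.1 y.1]
  · by_cases hxy : x.1 = y.1
    · simpa [hxy] using hnn y.1 y.1
    by_cases hyz : y.1 = z.1
    · simpa [hyz] using hnn z.1 z.1
    by_cases hxz : x.1 = z.1
    · simpa only [treeDist, if_pos hxz] using add_nonneg (hnn x.1 y.1) (hnn y.1 z.1)
    simp only [treeDist, if_neg hxy, if_neg hyz, if_neg hxz]
    refine (hε (PiNat.min_firstDiff_le x.1 y.1 z.1 hxz)).trans ?_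
    rcases min_choice (PiNat.firstDiff x.1 y.1) (PiNat.firstDiff y.1 z.1) with h | h <;> rw [h]
    · exact le_add_of_nonneg_right (hpos _).le
    · exact le_add_of_nonneg_left (hpos _).le

theorem treeDist_le_of_forall_lt_eq (hpos : ∀ n, 0 < ε n) (hε : Antitone ε) {x y : ℕ → L}
    {n : ℕ} (h : ∀ m < n, x m = y m) : treeDist ε x y ≤ ε n := by
  unfold treeDist
  split_ifs with hxy
  · exact (hpos n).le
  · exact hε (not_lt.1 fun hlt ↦ PiNat.apply_firstDiff_ne hxy (h _ hlt))

theorem le_treeDist_of_ne (hε : Antitone ε) {x y : ℕ → L} {n : ℕ} (h : x n ≠ y n) :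
    ε n ≤ treeDist ε x y := by
  rw [treeDist, if_neg fun hxy ↦ h (congrFun hxy n)]
  exact hε (not_lt.1 fun hlt ↦ h (PiNat.apply_eq_of_lt_firstDiff hlt))

open Classical in
/-- A rapidly decreasing sequence whose deviation from `16⁻ⁿ` codes membership in `A`. -/
noncomputable def codeScale (A : Set ℕ) (n : ℕ) : ℝ :=
  (1 / 16) ^ n * if n ∈ A then 1 / 8 else 1

theorem codeScale_pos (A : Set ℕ) (n : ℕ) : 0 < codeScale A n := by
  unfold codeScale; split_ifs <;> positivity

theorem codeScale_antitone (A : Set ℕ) : Antitone (codeScale A) := by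
  refine antitone_nat_of_succ_le fun n ↦ ?_
  have : (0 : ℝ) < (1 / 16) ^ n := by positivity
  unfold codeScale
  rw [pow_succ]
  split_ifs <;> linarith

/-- Sequences coded by finite lists, padded with `o`, together with the branches `c δ`. -/
def treePoint {L : Type} (o : L) (c : L → ℕ → L) : List L ⊕ L → ℕ → L :=
  Sum.elim (fun l n ↦ l.getD n o) c

end TreeMetric

section Coding

open Cardinal Order Set

variable {L : Type}

/-- The subset of `ℕ` read off from the distances of `x` to the initial segments below `a n`. -/
def codedSet [LinearOrder L] (d : L → L → ℝ) (x : L) (a : ℕ → L) : Set ℕ :=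
  {n | ∃ z < a n, d x z < (1 / 16) ^ n / 4}

theorem mk_range_treePoint [Infinite L] (o : L) (c : L → ℕ → L) :
    #(range (treePoint o c)) = #L := by
  apply le_antisymm
  · refine mk_range_le.trans ?_
    simp [mk_list_eq_mk]
  · refine mk_le_of_injective
      (f := fun a ↦ (⟨treePoint o c (.inl [a]), mem_range_self _⟩ : range (treePoint o c))) ?_
    intro a b hab
    simpa [treePoint] using congrFun (congrArg Subtype.val hab) 0

theorem exists_forall_list_lt [LinearOrder L] (hL : ℵ₀ < cof L) {s : Set L} (hs : #s < cof L)
    (F : List L → L) : ∃ b, ∀ l : List L, (∀ x ∈ l, x ∈ s) → F l < b := by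
  obtain ⟨b, hb⟩ := exists_forall_lt_of_mk_lt_cof (fun l : List s ↦ F (l.map Subtype.val))
    ((mk_list_le_max _).trans_lt (max_lt hL hs))
  refine ⟨b, fun l hl ↦ ?_⟩
  lift l to List s using hl
  exact hb l

theorem exists_mem_iff_codedSet [LinearOrder L] (hL : ℵ₀ < cof L)
    (hsmall : ∀ b : L, #(Iio b) < cof L) (o : L) {c : L → ℕ → L}
    (hc : ∀ h : L → L, ∃ δ, StrictMono (c δ) ∧ ∀ n, c δ n ∈ closurePoints h ∧ ∃ b, b < c δ n)
    (A : Set ℕ)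
    {d : L → L → ℝ} (hd : IsMetricFun d) {f : range (treePoint o c) → L}
    (hf : ∀ x y, x ≠ y → treeDist (codeScale A) x.1 y.1 / 2 < d (f x) (f y) ∧
      d (f x) (f y) < 2 * treeDist (codeScale A) x.1 y.1) :
    ∃ x δ, codedSet d x (c δ) = A := by
  obtain ⟨-, hsymm, htri⟩ := hd
  have hpos := codeScale_pos A
  have hanti := codeScale_antitone A
  let P (p : List L ⊕ L) : range (treePoint o c) := ⟨treePoint o c p, mem_range_self p⟩
  have hsmall' (b : L) : #(Iic b) < cof L := by
    obtain ⟨b', hb', -⟩ := exists_forall_le_lt hL.le hsmall id b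
    exact (mk_le_mk_of_subset (Iic_subset_Iio.2 hb')).trans_lt (hsmall b')
  choose h₁ hh₁ using fun b ↦ exists_forall_list_lt hL (hsmall' b) fun l ↦ f (P (.inl l))
  have hwit (z : L) (n : ℕ) : ∃ y, (∃ y', d (f y') z < (1 / 16) ^ n / 4) →
      d (f y) z < (1 / 16) ^ n / 4 := by
    by_cases h : ∃ y', d (f y') z < (1 / 16) ^ n / 4
    · exact ⟨h.choose, fun _ ↦ h.choose_spec⟩
    · exact ⟨P (.inl []), fun h' ↦ absurd h' h⟩
  choose w hw using hwit
  have hw₂ (b : L) : ∃ u, ∀ p : Iic b × ℕ × ℕ, (w p.1 p.2.1).1 p.2.2 < u := by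
    refine exists_forall_lt_of_mk_lt_cof _ ?_
    simp only [mk_prod, lift_id, mk_nat, aleph0_mul_aleph0]
    exact mul_lt_of_lt hL.le (hsmall' b) hL
  choose h₂ hh₂ using hw₂
  obtain ⟨δ, hmono, hcl⟩ := hc fun b ↦ max (h₁ b) (h₂ b)
  refine ⟨f (P (.inr δ)), δ, ?_⟩
  have hpow (n : ℕ) : (0 : ℝ) < (1 / 16) ^ n := by positivity
  ext n
  obtain ⟨hcln, b₀, hb₀⟩ := hcl n
  constructor
  · rintro ⟨z, hz, hdz⟩
    by_contra hnA
    have hwz := hw z n ⟨_, hdz⟩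
    set y := w z n
    have hyn : y.1 n ≠ c δ n :=
      (((hh₂ z ⟨⟨z, le_rfl⟩, n, n⟩).trans_le (le_max_right _ _)).trans (hcln z hz)).ne
    have hlow := le_treeDist_of_ne (y := (P (.inr δ)).1) hanti hyn
    have hne : y ≠ P (.inr δ) := fun h ↦ hyn (congrFun (congrArg Subtype.val h) n)
    have hfy := (hf _ _ hne).1
    have htriz := htri (f y) z (f (P (.inr δ)))
    rw [hsymm z] at htriz
    rw [codeScale, if_neg hnA, mul_one] at hlow
    linarith
  · intro hnA
    let l := (List.range n).map (c δ)
    have hl : f (P (.inl l)) < c δ n := by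
      obtain ⟨b, hb, hlb⟩ : ∃ b < c δ n, ∀ x ∈ l, x ≤ b := by
        rcases n with _ | n
        · exact ⟨b₀, hb₀, by simp [l]⟩
        · refine ⟨c δ n, hmono n.lt_succ_self, ?_⟩
          simp only [l, List.mem_map, List.mem_range, forall_exists_index, and_imp]
          rintro _ m hm rfl
          exact hmono.monotone (Nat.le_of_lt_succ hm)
      exact ((hh₁ b l hlb).trans_le (le_max_left _ _)).trans (hcln b hb)
    have hne : P (.inr δ) ≠ P (.inl l) := fun h ↦ by
      have hval (m : ℕ) (hm : n ≤ m) : c δ m = o := by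
        simpa [P, treePoint, l, hm] using congrFun (congrArg Subtype.val h) m
      exact (hmono n.lt_succ_self).ne
        ((hval n le_rfl).trans (hval (n + 1) n.le_succ).symm)
    have hup : treeDist (codeScale A) (P (.inr δ)).1 (P (.inl l)).1 ≤ codeScale A n :=
      treeDist_le_of_forall_lt_eq hpos hanti fun m hm ↦ by
        simp [P, treePoint, l, hm]
    rw [codeScale, if_pos hnA] at hup
    exact ⟨_, hl, by linarith [(hf _ _ hne).2]⟩

end Coding

/-- Kojman–Shelah: if `ℵ₁ < lam < 2^{ℵ₀}` is regular, then for every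
`κ < 2^{ℵ₀}` and metric spaces `{(X, d_i) : i < κ}` of cardinality `lam` there is a
metric space of cardinality `lam` not almost isometrically embeddable into any
`(X, d_i)`. -/
theorem stmt_12 (lam : Cardinal.{0}) (hreg : lam.IsRegular)
    (h1 : Cardinal.aleph 1 < lam) (h2 : lam < 2 ^ Cardinal.aleph0)
    (X : Type) (hX : Cardinal.mk X = lam)
    (ι : Type) (hι : Cardinal.mk ι < 2 ^ Cardinal.aleph0)
    (d : ι → X → X → ℝ) (hd : ∀ i, IsMetricFun (d i)) :
    ∃ (Y : Type) (dY : Y → Y → ℝ), IsMetricFun dY ∧ Cardinal.mk Y = lam ∧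
      ∀ i, ¬ AlmostIsomEmb dY (d i) := by
  let L := lam.ord.ToType
  have hcof : Order.cof L = lam := by rw [Ordinal.cof_toType, hreg.cof_ord]
  have hL : Cardinal.mk L = lam := Cardinal.mk_ord_toType lam
  have hsmall (b : L) : Cardinal.mk (Set.Iio b) < Order.cof L := by
    rw [hcof]
    exact (Cardinal.mk_Iio_lt b (by rw [hL, Ordinal.type_toType])).trans_eq hL
  have hL₁ : Cardinal.aleph 1 < Order.cof L := hcof.symm ▸ h1
  have hL₀ : Cardinal.aleph0 < Order.cof L := Cardinal.aleph0_lt_aleph_one.trans hL₁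
  have : Infinite L := Cardinal.infinite_iff.2 (hL.symm ▸ hreg.aleph0_le)
  obtain ⟨o⟩ : Nonempty L := inferInstance
  obtain ⟨c, hc⟩ : ∃ c : L → ℕ → L, ∀ h : L → L, ∃ δ, StrictMono (c δ) ∧
      ∀ n, c δ n ∈ closurePoints h ∧ ∃ b, b < c δ n := by
    obtain ⟨c, hc⟩ := exists_club_guessing hL₁ hsmall
    refine ⟨fun δ n ↦ c δ (n + 1), fun h ↦ ?_⟩
    obtain ⟨δ, hmono, hmem⟩ := hc h
    exact ⟨δ, fun m n hmn ↦ hmono (by lia), fun n ↦ ⟨hmem _, c δ n, hmono n.lt_succ_self⟩⟩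
  obtain ⟨e⟩ : Nonempty (X ≃ L) := Cardinal.eq.1 (hX.trans hL.symm)
  let d' (i : ι) (x y : L) : ℝ := d i (e.symm x) (e.symm y)
  have hd' (i : ι) : IsMetricFun (d' i) := by
    obtain ⟨h0, hs, ht⟩ := hd i
    exact ⟨fun x y ↦ by simp [d', h0], fun x y ↦ hs _ _, fun x y z ↦ ht _ _ _⟩
  obtain ⟨A, hA⟩ : ∃ A : Set ℕ, ∀ p : ι × L × L,
      codedSet (d' p.1) p.2.1 (c p.2.2) ≠ A := by
    by_contra! H
    have hsurj := Cardinal.mk_le_of_surjective H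
    simp only [Cardinal.mk_set, Cardinal.mk_nat, Cardinal.mk_prod, Cardinal.lift_id, hL] at hsurj
    have hω : Cardinal.aleph0 ≤ (2 : Cardinal.{0}) ^ Cardinal.aleph0 :=
      (Cardinal.cantor _).le
    exact hsurj.not_gt (Cardinal.mul_lt_of_lt hω hι (Cardinal.mul_lt_of_lt hω h2 h2))
  refine ⟨Set.range (treePoint o c), fun x y ↦ treeDist (codeScale A) x.1 y.1,
    isMetricFun_treeDist (codeScale_pos A) (codeScale_antitone A) _,
    (mk_range_treePoint o c).trans hL, fun i hemb ↦ ?_⟩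
  obtain ⟨f, -, hf⟩ := hemb 2 one_lt_two
  obtain ⟨x, δ, hx⟩ := exists_mem_iff_codedSet hL₀ hsmall o hc A (hd' i) (f := e ∘ f)
    fun x y hxy ↦ by simpa [d'] using hf x y hxy
  exact hA (i, x, δ) hx
end

section
/- For every infinite cardinal λ there is no universal K_{ℵ₀}-free graph of size λ: for every simple graph G with λ vertices containing no infinite set of pairwise adjacent vertices, there exists a simple graph with λ vertices containing no infinite set of pairwise adjacent vertices that admits no weak embedding into G. -/
/-- A simple graph is `K_{ℵ₀}`-free if it contains no infinite set of pairwise adjacent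
vertices. -/
def KAleph0Free {V : Type} (G : SimpleGraph V) : Prop :=
  ¬ ∃ s : Set V, s.Pairwise G.Adj ∧ s.Infinite

/-- The cone over a simple graph: `none` is joined to every vertex of `G`. -/
def coneGraph {V : Type} (G : SimpleGraph V) : SimpleGraph (Option V) where
  Adj a b := a ≠ b ∧ ∀ u v, a = some u → b = some v → G.Adj u v
  symm := ⟨fun _ _ h => ⟨h.1.symm, fun u v hu hv => (h.2 v u hv hu).symm⟩⟩
  loopless := ⟨fun _ h => h.1 rfl⟩

theorem KAleph0Free.coneGraph {V : Type} {G : SimpleGraph V} (hG : KAleph0Free G) :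
    KAleph0Free (coneGraph G) := by
  rintro ⟨s, hs, hinf⟩
  refine hG ⟨some ⁻¹' s, fun u hu v hv huv => ?_, fun hfin => hinf ?_⟩
  · exact (hs hu hv (by simpa using huv)).2 u v rfl rfl
  · refine ((hfin.image some).insert none).subset fun a ha => ?_
    cases a with
    | none => exact Set.mem_insert _ _
    | some u => exact Set.mem_insert_of_mem _ ⟨u, ha, rfl⟩

/-- If the cone over `G` maps homomorphically to `G`, iterating the map on the image of the apex
yields an infinite clique. -/
theorem KAleph0Free.not_hom_coneGraph {V : Type} {G : SimpleGraph V} (hG : KAleph0Free G)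
    (f : Option V → V) (hf : ∀ u v, (_root_.coneGraph G).Adj u v → G.Adj (f u) (f v)) :
    False := by
  let g : V → V := fun v => f (some v)
  have hg : ∀ u v, G.Adj u v → G.Adj (g u) (g v) := fun u v h =>
    hf _ _ ⟨by simpa using h.ne, fun a b ha hb => by
      cases ha
      cases hb
      exact h⟩
  have happ : ∀ v, G.Adj (f none) (g v) := fun v =>
    hf _ _ ⟨by simp, fun a b ha hb => by cases ha⟩
  let x : ℕ → V := fun n => g^[n] (f none)
  have hx : ∀ n k, G.Adj (x n) (x (n + k + 1)) := by
    intro n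
    induction n with
    | zero =>
      intro k
      simpa [x, Function.iterate_succ_apply'] using happ (x k)
    | succ n ih =>
      intro k
      have h := hg _ _ (ih k)
      rw [show n + 1 + k + 1 = (n + k + 1) + 1 by omega]
      simpa only [x, Function.iterate_succ_apply'] using h
  have hlt : ∀ m n, m < n → G.Adj (x m) (x n) := by
    intro m n h
    obtain ⟨k, rfl⟩ := Nat.exists_eq_add_of_lt h
    exact hx m k
  have hne : ∀ m n, m ≠ n → G.Adj (x m) (x n) := fun m n h =>
    h.lt_or_gt.elim (hlt m n) fun h' => (hlt n m h').symm
  refine hG ⟨Set.range x, ?_, Set.infinite_range_of_injective fun m n h => ?_⟩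
  · rintro _ ⟨m, rfl⟩ _ ⟨n, rfl⟩ h
    exact hne m n fun e => h (congrArg x e)
  · by_contra e
    exact (hne m n e).ne h

/-- for every infinite cardinal `lam` there is no universal `K_{ℵ₀}`-free
graph with `lam` vertices. -/
theorem stmt_18 (lam : Cardinal.{0}) (hlam : Cardinal.aleph0 ≤ lam)
    (V : Type) (G : SimpleGraph V) (hG : KAleph0Free G) (hV : Cardinal.mk V = lam) :
    ∃ (W : Type) (H : SimpleGraph W), KAleph0Free H ∧ Cardinal.mk W = lam ∧
      ¬ ∃ f : W → V, Function.Injective f ∧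
        ∀ u v : W, H.Adj u v → G.Adj (f u) (f v) := by
  refine ⟨Option V, coneGraph G, hG.coneGraph, ?_, ?_⟩
  · rw [Cardinal.mk_option, hV, Cardinal.add_one_eq hlam]
  · rintro ⟨f, -, hf⟩
    exact hG.not_hom_coneGraph f hf
end
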